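/- There is no NITA (A,B) generated by a non-real element b_3 of degree 3 with no nontrivial basis elements of degree 1 or 2 satisfying b_3·b̄_3 = 1 + b_8, b_3² = c_3 + b_6 with c_3 ≠ b_3, b̄_3, (b_3·b_8, b_3·b_8) = 4, and c_3² = r_4 + s_5 for basis elements r_4, s_5 of degrees 4 and 5. -/

import Mathlib

/-- A normalized table algebra datum on a commutative `ℂ`-algebra `A`:
a distinguished basis `B` containing `1`, an involutive algebra
endomorphism `bar` permuting `B`, a bilinear form for which `B` is
orthonormal and which satisfies `(a, bc) = (a·b̄, c)`, nonnegative real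
structure constants, and a degree homomorphism positive on `B`. -/
structure TAData (A : Type) [CommRing A] [Algebra ℂ A] : Type where
  B : Finset A
  one_mem : (1 : A) ∈ B
  indep : LinearIndependent ℂ (fun b : {x : A // x ∈ B} => (b : A))
  span_top : Submodule.span ℂ (B : Set A) = ⊤
  bar : A →ₐ[ℂ] A
  bar_bar : ∀ a : A, bar (bar a) = a
  bar_mem : ∀ b ∈ B, bar b ∈ B
  ip : A →ₗ[ℂ] A →ₗ[ℂ] ℂ
  ip_symm : ∀ a b : A, ip a b = ip b a
  ip_self : ∀ b ∈ B, ip b b = 1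
  ip_ne : ∀ b ∈ B, ∀ c ∈ B, b ≠ c → ip b c = 0
  ip_assoc : ∀ a b c : A, ip a (b * c) = ip (a * bar b) c
  struct_nonneg : ∀ b ∈ B, ∀ c ∈ B, ∀ d ∈ B, ∃ r : ℝ, 0 ≤ r ∧ ip (b * c) d = (r : ℂ)
  deg : A →ₐ[ℂ] ℂ
  deg_pos : ∀ b ∈ B, ∃ r : ℝ, 0 < r ∧ deg b = (r : ℂ)

namespace TAData

variable {A : Type} [CommRing A] [Algebra ℂ A]

/-- Integrality (making a table algebra a NITA): all structure constants are
nonnegative integers and all degrees are positive integers. -/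
def Integral (T : TAData A) : Prop :=
  (∀ b ∈ T.B, ∀ c ∈ T.B, ∀ d ∈ T.B, ∃ n : ℕ, T.ip (b * c) d = (n : ℂ)) ∧
  (∀ b ∈ T.B, ∃ n : ℕ, 0 < n ∧ T.deg b = (n : ℂ))

/-- `L₁(B) = {1}` and `L₂(B) = ∅`: no nontrivial basis elements of degree 1 or 2. -/
def NoSmall (T : TAData A) : Prop :=
  (∀ b ∈ T.B, T.deg b = 1 → b = 1) ∧ (∀ b ∈ T.B, T.deg b ≠ 2)

/-- The table algebra is generated (as an algebra) by `b` (and its conjugate). -/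
def GeneratedBy (T : TAData A) (b : A) : Prop :=
  Algebra.adjoin ℂ ({b, T.bar b} : Set A) = ⊤

/-- A table subset of `B`: contains `1`, closed under the involution and under
supports of products. -/
def IsTableSubset (T : TAData A) (C : Set A) : Prop :=
  C ⊆ ↑T.B ∧ (1 : A) ∈ C ∧ (∀ b ∈ C, T.bar b ∈ C) ∧
    ∀ b ∈ C, ∀ c ∈ C, ∀ d ∈ T.B, T.ip (b * c) d ≠ 0 → d ∈ C

end TAData


/-- An integral table algebra over `ℤ`: a commutative ring additively generated by a finite
orthonormal basis `B`, with `ℤ`-valued form and degree, in which every basis element other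
than `1` has degree at least `3`. -/
structure IntTA (R : Type) [CommRing R] where
  B : Finset R
  one_mem : (1 : R) ∈ B
  bar : R →+* R
  bar_bar : ∀ a, bar (bar a) = a
  bar_mem : ∀ b ∈ B, bar b ∈ B
  ip : R → R → ℤ
  ip_add_left : ∀ a b c, ip (a + b) c = ip a c + ip b c
  ip_symm : ∀ a b, ip a b = ip b a
  ip_self : ∀ b ∈ B, ip b b = 1
  ip_ne : ∀ b ∈ B, ∀ c ∈ B, b ≠ c → ip b c = 0
  ip_assoc : ∀ a b c, ip a (b * c) = ip (a * bar b) c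
  deg : R →+* ℤ
  deg_pos : ∀ b ∈ B, 0 < deg b
  mul_mem : ∀ b ∈ B, ∀ c ∈ B, b * c ∈ AddSubmonoid.closure (B : Set R)
  eq_one_or_three_le : ∀ b ∈ B, b = 1 ∨ 3 ≤ deg b

namespace IntTA

variable {R : Type} [CommRing R] (T : IntTA R)

/-- Nonnegative integral combinations of basis elements. -/
def Pos (a : R) : Prop := a ∈ AddSubmonoid.closure (T.B : Set R)

variable {T} {a a' x y z u : R}

lemma ip_add_right (a b c : R) : T.ip a (b + c) = T.ip a b + T.ip a c := by
  rw [T.ip_symm, T.ip_add_left, T.ip_symm b, T.ip_symm c]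

lemma ip_zero_left (a : R) : T.ip 0 a = 0 := by
  have := T.ip_add_left 0 0 a
  rw [add_zero] at this
  omega

lemma ip_zero_right (a : R) : T.ip a 0 = 0 := by rw [T.ip_symm, ip_zero_left]

lemma ip_two_mul_left (a b : R) : T.ip (2 * a) b = 2 * T.ip a b := by
  rw [two_mul, T.ip_add_left, two_mul]

lemma ip_three_mul_left (a b : R) : T.ip (3 * a) b = 3 * T.ip a b := by
  rw [show 3 * a = a + a + a by ring, T.ip_add_left, T.ip_add_left]; ring

lemma ip_mul_left (x a b : R) : T.ip (x * a) b = T.ip a (T.bar x * b) := by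
  rw [T.ip_assoc, T.bar_bar, mul_comm]

lemma ip_bar_bar (a b : R) : T.ip (T.bar a) (T.bar b) = T.ip a b := by
  have h : ∀ a b : R, T.ip (T.bar a) b = T.ip (T.bar b) a := fun a b => by
    have h1 := T.ip_assoc 1 a b
    have h2 := T.ip_assoc 1 b a
    rw [one_mul] at h1 h2
    rw [← h1, ← h2, mul_comm]
  rw [h, T.bar_bar, T.ip_symm]

lemma ip_bar_left (a b : R) : T.ip (T.bar a) b = T.ip a (T.bar b) := by
  rw [← ip_bar_bar, T.bar_bar]

lemma bar_one : T.bar 1 = 1 := map_one _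

lemma Pos.of_mem (h : x ∈ T.B) : T.Pos x := AddSubmonoid.subset_closure h

lemma Pos.zero : T.Pos 0 := AddSubmonoid.zero_mem _

lemma Pos.add (h : T.Pos a) (h' : T.Pos a') : T.Pos (a + a') := AddSubmonoid.add_mem _ h h'

lemma Pos.mul (h : T.Pos a) (h' : T.Pos a') : T.Pos (a * a') := by
  induction h using AddSubmonoid.closure_induction with
  | mem x hx =>
    induction h' using AddSubmonoid.closure_induction with
    | mem y hy => exact T.mul_mem x hx y hy
    | zero => rw [mul_zero]; exact Pos.zero
    | add y z _ _ hy hz => rw [mul_add]; exact hy.add hz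
  | zero => rw [zero_mul]; exact Pos.zero
  | add y z _ _ hy hz => rw [add_mul]; exact hy.add hz

lemma Pos.bar (h : T.Pos a) : T.Pos (T.bar a) := by
  induction h using AddSubmonoid.closure_induction with
  | mem x hx => exact Pos.of_mem (T.bar_mem x hx)
  | zero => rw [map_zero]; exact Pos.zero
  | add y z _ _ hy hz => rw [map_add]; exact hy.add hz

lemma ip_mem (hx : x ∈ T.B) (hy : y ∈ T.B) :
    T.ip x y = 0 ∧ x ≠ y ∨ T.ip x y = 1 ∧ x = y := by
  by_cases h : x = y
  · subst h; exact Or.inr ⟨T.ip_self x hx, rfl⟩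
  · exact Or.inl ⟨T.ip_ne x hx y hy h, h⟩

lemma ip_mem_nonneg (hx : x ∈ T.B) (hy : y ∈ T.B) : 0 ≤ T.ip x y := by
  rcases ip_mem hx hy with h | h <;> omega

lemma ip_eq_zero_of_deg (hx : x ∈ T.B) (hy : y ∈ T.B) (h : T.deg x ≠ T.deg y) :
    T.ip x y = 0 :=
  T.ip_ne x hx y hy fun e => h (by rw [e])

lemma eq_of_ip (hx : x ∈ T.B) (hy : y ∈ T.B) (h : 1 ≤ T.ip x y) : x = y := by
  rcases ip_mem hx hy with h' | h'
  · omega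
  · exact h'.2

lemma Pos.ip_nonneg (h : T.Pos a) (h' : T.Pos a') : 0 ≤ T.ip a a' := by
  induction h using AddSubmonoid.closure_induction with
  | mem x hx =>
    induction h' using AddSubmonoid.closure_induction with
    | mem y hy => exact ip_mem_nonneg hx hy
    | zero => rw [ip_zero_right]
    | add y z _ _ hy hz => rw [ip_add_right]; omega
  | zero => rw [ip_zero_left]
  | add y z _ _ hy hz => rw [T.ip_add_left]; omega

lemma Pos.deg_nonneg (h : T.Pos a) : 0 ≤ T.deg a := by
  induction h using AddSubmonoid.closure_induction with
  | mem x hx => exact (T.deg_pos x hx).le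
  | zero => rw [map_zero]
  | add y z _ _ hy hz => rw [map_add]; omega

lemma Pos.peel (h : T.Pos a) (hx : x ∈ T.B) (h1 : 1 ≤ T.ip a x) :
    ∃ a', T.Pos a' ∧ a = x + a' := by
  induction h using AddSubmonoid.closure_induction with
  | mem y hy => exact ⟨0, Pos.zero, by rw [eq_of_ip hy hx h1, add_zero]⟩
  | zero => rw [ip_zero_left] at h1; omega
  | add y z hy hz ihy ihz =>
    rw [T.ip_add_left] at h1
    by_cases h2 : 1 ≤ T.ip y x
    · obtain ⟨y', p, e⟩ := ihy h2
      exact ⟨y' + z, p.add hz, by rw [e]; ring⟩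
    · obtain ⟨z', p, e⟩ := ihz (by omega)
      exact ⟨y + z', Pos.add hy p, by rw [e]; ring⟩

lemma Pos.eq_zero_or_peel (h : T.Pos a) : a = 0 ∨ ∃ x ∈ T.B, ∃ a', T.Pos a' ∧ a = x + a' := by
  induction h using AddSubmonoid.closure_induction with
  | mem y hy => exact Or.inr ⟨y, hy, 0, Pos.zero, (add_zero y).symm⟩
  | zero => exact Or.inl rfl
  | add y z hy hz ihy ihz =>
    rcases ihy with rfl | ⟨x, hx, y', p, e⟩
    · simpa using ihz
    · exact Or.inr ⟨x, hx, y' + z, p.add hz, by rw [e]; ring⟩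

lemma Pos.eq_zero_of_norm (h : T.Pos a) (h0 : T.ip a a ≤ 0) : a = 0 := by
  rcases h.eq_zero_or_peel with h' | ⟨x, hx, a', p, rfl⟩
  · exact h'
  · have h1 := (Pos.of_mem hx).ip_nonneg p
    have h2 := p.ip_nonneg p
    have h3 := T.ip_self x hx
    rw [T.ip_add_left, ip_add_right, ip_add_right, T.ip_symm a' x] at h0
    omega

lemma Pos.eq_zero_of_deg (h : T.Pos a) (h0 : T.deg a ≤ 0) : a = 0 := by
  rcases h.eq_zero_or_peel with h' | ⟨x, hx, a', p, rfl⟩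
  · exact h'
  · have h1 := p.deg_nonneg
    have h2 := T.deg_pos x hx
    rw [map_add] at h0
    omega

lemma ip_add_self (x a : R) :
    T.ip (x + a) (x + a) = T.ip x x + 2 * T.ip x a + T.ip a a := by
  rw [T.ip_add_left, ip_add_right, ip_add_right, T.ip_symm a x]; ring

lemma Pos.mem_of_norm (h : T.Pos a) (h1 : T.ip a a = 1) : a ∈ T.B := by
  rcases h.eq_zero_or_peel with rfl | ⟨x, hx, a', p, rfl⟩
  · rw [ip_zero_left] at h1; omega
  · have h2 := (Pos.of_mem hx).ip_nonneg p
    have h3 := p.ip_nonneg p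
    rw [ip_add_self, T.ip_self x hx] at h1
    rw [p.eq_zero_of_norm (by omega), add_zero]
    exact hx

lemma Pos.of_norm_two (h : T.Pos a) (h1 : T.ip a a = 2) :
    ∃ x ∈ T.B, ∃ y ∈ T.B, a = x + y ∧ T.ip x y = 0 := by
  rcases h.eq_zero_or_peel with rfl | ⟨x, hx, a', p, rfl⟩
  · rw [ip_zero_left] at h1; omega
  · have h2 := (Pos.of_mem hx).ip_nonneg p
    have h3 := p.ip_nonneg p
    rw [ip_add_self, T.ip_self x hx] at h1
    exact ⟨x, hx, a', p.mem_of_norm (by omega), rfl, by omega⟩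

/-- In a nonnegative element of squared length at most `3` every multiplicity is at most `1`;
the rest of it has squared length one less. -/
lemma Pos.peel_norm (h : T.Pos a) (hx : x ∈ T.B) (h1 : 1 ≤ T.ip a x) (h2 : T.ip a a ≤ 3) :
    ∃ a', T.Pos a' ∧ a = x + a' ∧ T.ip x a' = 0 ∧ T.ip a' a' = T.ip a a - 1 := by
  obtain ⟨a', p, rfl⟩ := h.peel hx h1
  have h3 := (Pos.of_mem hx).ip_nonneg p
  have h4 := p.ip_nonneg p
  rw [ip_add_self, T.ip_self x hx] at *
  have h5 : T.ip x a' = 0 := by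
    by_contra h6
    have h7 : T.ip a' a' ≤ 0 := by omega
    rw [p.eq_zero_of_norm h7, ip_zero_right] at h6
    omega
  exact ⟨a', p, rfl, h5, by omega⟩

lemma Pos.peel_two (h : T.Pos a) (hx : x ∈ T.B) (hy : y ∈ T.B) (hxy : T.ip x y = 0)
    (h1 : 1 ≤ T.ip a x) (h2 : 1 ≤ T.ip a y) : ∃ a', T.Pos a' ∧ a = x + y + a' := by
  obtain ⟨a1, p1, rfl⟩ := h.peel hx h1
  rw [T.ip_add_left] at h2
  obtain ⟨a2, p2, rfl⟩ := p1.peel hy (by omega)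
  exact ⟨a2, p2, by ring⟩

lemma Pos.peel_three (h : T.Pos a) (hx : x ∈ T.B) (hy : y ∈ T.B) (hz : z ∈ T.B)
    (hxy : T.ip x y = 0) (hxz : T.ip x z = 0) (hyz : T.ip y z = 0)
    (h1 : 1 ≤ T.ip a x) (h2 : 1 ≤ T.ip a y) (h3 : 1 ≤ T.ip a z) :
    ∃ a', T.Pos a' ∧ a = x + y + z + a' := by
  obtain ⟨a1, p1, rfl⟩ := h.peel_two hx hy hxy h1 h2
  rw [T.ip_add_left, T.ip_add_left] at h3
  obtain ⟨a2, p2, rfl⟩ := p1.peel hz (by omega)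
  exact ⟨a2, p2, by ring⟩

lemma Pos.deg_two (h : T.Pos a) (hx : x ∈ T.B) (hy : y ∈ T.B) (hxy : T.ip x y = 0)
    (h1 : 1 ≤ T.ip a x) (h2 : 1 ≤ T.ip a y) : T.deg x + T.deg y ≤ T.deg a := by
  obtain ⟨a', p, rfl⟩ := h.peel_two hx hy hxy h1 h2
  have := p.deg_nonneg
  rw [map_add, map_add]; omega

lemma Pos.deg_three (h : T.Pos a) (hx : x ∈ T.B) (hy : y ∈ T.B) (hz : z ∈ T.B)
    (hxy : T.ip x y = 0) (hxz : T.ip x z = 0) (hyz : T.ip y z = 0)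
    (h1 : 1 ≤ T.ip a x) (h2 : 1 ≤ T.ip a y) (h3 : 1 ≤ T.ip a z) :
    T.deg x + T.deg y + T.deg z ≤ T.deg a := by
  obtain ⟨a', p, rfl⟩ := h.peel_three hx hy hz hxy hxz hyz h1 h2 h3
  have := p.deg_nonneg
  rw [map_add, map_add, map_add]; omega

lemma Pos.ip_mul_deg_le (h : T.Pos a) (hx : x ∈ T.B) : T.ip a x * T.deg x ≤ T.deg a := by
  have key : ∀ n : ℕ, ∀ a, T.Pos a → T.ip a x = n → T.ip a x * T.deg x ≤ T.deg a := by
    intro n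
    induction n with
    | zero => intro a h e; rw [e]; simpa using h.deg_nonneg
    | succ n ih =>
      intro a h e
      obtain ⟨a', p, rfl⟩ := h.peel hx (by rw [e]; push_cast; omega)
      rw [T.ip_add_left, T.ip_self x hx] at *
      have h1 := ih a' p (by push_cast at e; omega)
      rw [map_add]
      linarith
  exact key (T.ip a x).toNat a h (Int.toNat_of_nonneg (h.ip_nonneg (Pos.of_mem hx))).symm

lemma three_le_deg (hx : x ∈ T.B) (h1 : T.ip x 1 = 0) : 3 ≤ T.deg x := by
  rcases T.eq_one_or_three_le x hx with rfl | h
  · rw [T.ip_self 1 hx] at h1; omega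
  · exact h

lemma ip_one_of_deg (hx : x ∈ T.B) (h : 3 ≤ T.deg x) : T.ip x 1 = 0 :=
  ip_eq_zero_of_deg hx T.one_mem (by rw [map_one]; omega)

lemma Pos.eq_zero_or_three_le (h : T.Pos a) (h1 : T.ip a 1 = 0) : a = 0 ∨ 3 ≤ T.deg a := by
  rcases h.eq_zero_or_peel with h' | ⟨x, hx, a', p, rfl⟩
  · exact Or.inl h'
  · have h2 := ip_mem_nonneg hx T.one_mem
    have h3 := p.ip_nonneg (Pos.of_mem T.one_mem)
    rw [T.ip_add_left] at h1
    have h4 := three_le_deg hx (by omega)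
    have h5 := p.deg_nonneg
    rw [map_add]; omega

lemma Pos.mem_of_deg (h : T.Pos a) (h1 : T.ip a 1 = 0) (h2 : 0 < T.deg a)
    (h3 : T.deg a < 6) : a ∈ T.B := by
  rcases h.eq_zero_or_peel with rfl | ⟨x, hx, a', p, rfl⟩
  · rw [map_zero] at h2; omega
  · have h4 := ip_mem_nonneg hx T.one_mem
    have h5 := p.ip_nonneg (Pos.of_mem T.one_mem)
    rw [T.ip_add_left] at h1
    have h6 := three_le_deg hx (by omega)
    rw [map_add] at h3
    rcases p.eq_zero_or_three_le (by omega) with rfl | h7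
    · rwa [add_zero]
    · omega

lemma Pos.of_deg_seven (h : T.Pos a) (h1 : T.ip a 1 = 0) (h2 : T.deg a = 7) :
    a ∈ T.B ∨ ∃ x ∈ T.B, ∃ y ∈ T.B, a = x + y ∧ T.ip x y = 0 ∧ T.deg x = 3 ∧ T.deg y = 4 := by
  rcases h.eq_zero_or_peel with rfl | ⟨x, hx, a', p, rfl⟩
  · rw [map_zero] at h2; omega
  · have h4 := ip_mem_nonneg hx T.one_mem
    have h5 := p.ip_nonneg (Pos.of_mem T.one_mem)
    rw [T.ip_add_left] at h1
    have h6 := three_le_deg hx (by omega)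
    rw [map_add] at h2
    rcases p.eq_zero_or_three_le (by omega) with rfl | h7
    · rw [add_zero]; exact Or.inl hx
    · have h8 := p.mem_of_deg (by omega) (by omega) (by omega)
      have h9 := ip_eq_zero_of_deg hx h8 (by omega)
      rcases (by omega : T.deg x = 3 ∨ T.deg x = 4) with h10 | h10
      · exact Or.inr ⟨x, hx, a', h8, rfl, h9, h10, by omega⟩
      · exact Or.inr ⟨a', h8, x, hx, add_comm _ _, by rw [T.ip_symm, h9], by omega, h10⟩

lemma Pos.ip_le_two_of_deg_seven (h : T.Pos a) (h1 : T.ip a 1 = 0) (h2 : T.deg a = 7)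
    (h' : T.Pos a') (h2' : T.deg a' = 7) : T.ip a a' ≤ 2 := by
  rcases h.of_deg_seven h1 h2 with hx | ⟨x, hx, y, hy, rfl, hxy, dx, dy⟩
  · have := h'.ip_mul_deg_le hx
    rw [T.ip_symm]
    rw [h2, h2'] at this
    omega
  · rw [T.ip_add_left, T.ip_symm x, T.ip_symm y]
    have hx' := h'.ip_mul_deg_le hx
    have hy' := h'.ip_mul_deg_le hy
    rw [dx, h2'] at hx'
    rw [dy, h2'] at hy'
    by_contra hc
    obtain ⟨a1, p1, rfl⟩ := h'.peel_two hx hy hxy (by omega) (by omega)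
    rw [map_add, map_add] at h2'
    rw [p1.eq_zero_of_deg (by omega), add_zero, T.ip_add_left, T.ip_add_left, T.ip_self x hx,
      T.ip_self y hy, T.ip_symm y x] at hc
    omega

lemma Pos.ip_eq_zero_of_deg_seven (h : T.Pos a) (h1 : T.ip a 1 = 0) (h2 : T.deg a = 7)
    (hx : x ∈ T.B) (h3 : T.deg x = 5 ∨ T.deg x = 6 ∨ 8 ≤ T.deg x) : T.ip a x = 0 := by
  by_contra hc
  have hn := h.ip_nonneg (Pos.of_mem hx)
  obtain ⟨a1, p1, rfl⟩ := h.peel hx (by omega)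
  have h4 := ip_one_of_deg hx (by omega)
  rw [T.ip_add_left] at h1
  rw [map_add] at h2
  rcases p1.eq_zero_or_three_le (by omega) with rfl | h5
  · rw [map_zero] at h2; omega
  · omega

lemma ip_mul_mul {c E : R} (hc : c * T.bar c = 1 + E) (a b : R) :
    T.ip (c * a) (c * b) = T.ip a b + T.ip (E * a) b := by
  rw [ip_mul_left, ← mul_assoc, mul_comm _ c, hc, add_mul, one_mul, ip_add_right,
    T.ip_symm a (E * b), ip_mul_left]
  have : T.bar E = E := by
    have h := congrArg T.bar hc
    rw [map_mul, T.bar_bar, map_add, map_one, mul_comm, hc] at h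
    exact (add_left_cancel h).symm
  rw [this, T.ip_symm b]

lemma deg_bar (T : IntTA R) (a : R) (ha : T.Pos a) : T.deg (T.bar a) = T.deg a := by
  have expand : ∀ a, T.Pos a → ∑ x ∈ T.B, T.ip a x • x = a := by
    intro a h
    induction h using AddSubmonoid.closure_induction with
    | mem y hy =>
      rw [Finset.sum_eq_single_of_mem y hy]
      · rw [T.ip_self y hy, one_smul]
      · intro z hz hzy
        rw [T.ip_ne y hy z hz (Ne.symm hzy), zero_smul]
    | zero => simp [ip_zero_left]
    | add y z _ _ hy hz => simp_rw [T.ip_add_left, add_smul, Finset.sum_add_distrib, hy, hz]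
  have expand_deg : ∀ a, T.Pos a → T.deg a = ∑ x ∈ T.B, T.ip a x * T.deg x := by
    intro a h
    conv_lhs => rw [← expand a h]
    rw [map_sum]
    exact Finset.sum_congr rfl fun x _ => by rw [map_zsmul, smul_eq_mul]
  have pbar : ∀ x ∈ T.B, T.Pos (T.bar x) := fun x hx => (Pos.of_mem hx).bar
  let ω : ℤ := ∑ x ∈ T.B, T.deg x * T.deg x
  have hω : 0 < ω := Finset.sum_pos (fun x hx => mul_pos (T.deg_pos x hx) (T.deg_pos x hx))
    ⟨1, T.one_mem⟩
  have key : T.deg (T.bar a) * ω = T.deg a * ω := by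
    have h1 : T.deg (T.bar a) * ω
        = ∑ x ∈ T.B, ∑ y ∈ T.B, T.ip (T.bar a * x) y * T.deg y * T.deg x := by
      rw [Finset.mul_sum]
      refine Finset.sum_congr rfl fun x hx => ?_
      rw [← mul_assoc, ← map_mul, expand_deg _ (ha.bar.mul (Pos.of_mem hx)), Finset.sum_mul]
    have h2 : T.deg a * ω = ∑ x ∈ T.B, ∑ y ∈ T.B, T.ip (a * x) y * T.deg y * T.deg x := by
      rw [Finset.mul_sum]
      refine Finset.sum_congr rfl fun x hx => ?_
      rw [← mul_assoc, ← map_mul, expand_deg _ (ha.mul (Pos.of_mem hx)), Finset.sum_mul]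
    rw [h1, h2, Finset.sum_comm]
    refine Finset.sum_congr rfl fun x _ => Finset.sum_congr rfl fun y _ => ?_
    rw [ip_mul_left, T.bar_bar, T.ip_symm]; ring
  exact mul_right_cancel₀ hω.ne' key


lemma ip_mul_swap (x a y b : R) :
    T.ip (x * a) (y * b) = T.ip (T.bar y * a) (T.bar x * b) := by
  rw [ip_mul_left, ip_mul_left, T.bar_bar, mul_left_comm]

/-- The form is the trace of `a * bar b`. -/
lemma ip_congr {a b c d : R} (h : a * T.bar b = c * T.bar d) : T.ip a b = T.ip c d := by
  have key : ∀ a b, T.ip a b = T.ip (a * T.bar b) 1 := fun a b => by rw [← T.ip_assoc, mul_one]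
  rw [key a b, key c d, h]

lemma bar_eq_of_mul_bar {c E : R} (hc : c * T.bar c = 1 + E) : T.bar E = E := by
  have h := congrArg T.bar hc
  rw [map_mul, T.bar_bar, map_add, map_one, mul_comm, hc] at h
  exact (add_left_cancel h).symm

lemma exists_mul_bar (hx : x ∈ T.B) : ∃ X, T.Pos X ∧ x * T.bar x = 1 + X ∧ T.ip X 1 = 0 ∧
    T.bar X = X ∧ T.deg X = T.deg x * T.deg x - 1 := by
  have h1 : T.ip (x * T.bar x) 1 = 1 := by
    rw [ip_mul_left, mul_one, T.ip_self _ (T.bar_mem x hx)]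
  obtain ⟨X, p, e⟩ :=
    ((Pos.of_mem hx).mul (Pos.of_mem (T.bar_mem x hx))).peel T.one_mem (by omega)
  refine ⟨X, p, e, ?_, bar_eq_of_mul_bar e, ?_⟩
  · rw [e, T.ip_add_left, T.ip_self 1 T.one_mem] at h1
    omega
  · have h := congrArg T.deg e
    rw [map_mul, deg_bar T x (Pos.of_mem hx), map_add, map_one] at h
    omega

/-- The products that are forced by the hypotheses at the very beginning. -/
structure Config (T : IntTA R) (b E c y β v w r s : R) : Prop where
  hb : b ∈ T.B
  hE : E ∈ T.B
  hc : c ∈ T.B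
  hy : y ∈ T.B
  hβ : β ∈ T.B
  hv : v ∈ T.B
  hw : w ∈ T.B
  hr : r ∈ T.B
  hs : s ∈ T.B
  db : T.deg b = 3
  dE : T.deg E = 8
  dc : T.deg c = 3
  dy : T.deg y = 6
  dβ : T.deg β = 6
  dv : T.deg v = 9
  dw : T.deg w = 6
  dr : T.deg r = 4
  ds : T.deg s = 5
  barE : T.bar E = E
  bb : b * T.bar b = 1 + E
  cc : c * T.bar c = 1 + E
  sq : b * b = c + β
  csq : c * c = r + s
  bc : T.bar b * c = b + y
  cE : c * E = c + β + v + w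
  bY : b * y = c + v + w
  cr : T.bar c * r = c + v
  cs : T.bar c * s = c + β + w
  βw : T.ip β w = 0
  normE : T.ip (b * E) (b * E) = 4
  cb' : T.ip c (T.bar b) = 0

lemma exists_config {b E c β r s : R} (hb : b ∈ T.B) (db : T.deg b = 3) (hE : E ∈ T.B)
    (dE : T.deg E = 8) (bb : b * T.bar b = 1 + E) (hc : c ∈ T.B) (dc : T.deg c = 3)
    (cb' : c ≠ T.bar b) (hβ : β ∈ T.B) (dβ : T.deg β = 6) (sq : b * b = c + β)
    (normE : T.ip (b * E) (b * E) = 4) (hr : r ∈ T.B) (dr : T.deg r = 4) (hs : s ∈ T.B)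
    (ds : T.deg s = 5) (csq : c * c = r + s) : ∃ y v w, T.Config b E c y β v w r s := by
  have hb' := T.bar_mem b hb
  have barE := bar_eq_of_mul_bar bb
  have E1 := ip_one_of_deg hE (by omega)
  have cβ := ip_eq_zero_of_deg hc hβ (by omega)
  have rs := ip_eq_zero_of_deg hr hs (by omega)
  have n1 : T.ip (c * T.bar c) (c * T.bar c) = 2 := by
    rw [mul_comm c, ← ip_mul_swap, csq, ip_add_self, T.ip_self r hr, T.ip_self s hs, rs]; rfl
  have cc : c * T.bar c = 1 + E ∧ T.ip (T.bar b * c) (T.bar b * c) = 2 := by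
    obtain ⟨x, px, e, x1, -, dx⟩ := exists_mul_bar hc
    have hx : x ∈ T.B := by
      apply px.mem_of_norm
      rw [e, ip_add_self, T.ip_self 1 T.one_mem, T.ip_symm, x1] at n1
      omega
    have h1 : T.ip (T.bar b * c) (T.bar b * c) = 1 + T.ip E x := by
      rw [show T.ip (T.bar b * c) (T.bar b * c) = T.ip (b * T.bar b) (c * T.bar c) from
        ip_congr (by simp only [map_mul, T.bar_bar]; ring),
        bb, e, T.ip_add_left, ip_add_right, ip_add_right,
        T.ip_self 1 T.one_mem, T.ip_symm 1, x1, E1]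
      ring
    rcases ip_mem hE hx with ⟨h2, -⟩ | ⟨h2, rfl⟩
    · exfalso
      have hm := ((Pos.of_mem hb').mul (Pos.of_mem hc)).mem_of_norm (by omega)
      have h3 : T.ip (T.bar b * c) b = 1 := by
        rw [ip_mul_left, T.bar_bar, sq, ip_add_right, T.ip_self c hc, cβ]; rfl
      have h4 := congrArg T.deg (eq_of_ip hm hb (by omega))
      rw [map_mul, deg_bar T b (Pos.of_mem hb), db, dc] at h4
      omega
    · exact ⟨e, by omega⟩
  obtain ⟨cc, nbc⟩ := cc
  have bcb : T.ip (T.bar b * c) b = 1 := by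
    rw [ip_mul_left, T.bar_bar, sq, ip_add_right, T.ip_self c hc, cβ]; rfl
  obtain ⟨y, py, bc, by0, ny⟩ := ((Pos.of_mem hb').mul (Pos.of_mem hc)).peel_norm hb
    (by omega) (by omega)
  have hy := py.mem_of_norm (by omega)
  have dy : T.deg y = 6 := by
    have h := congrArg T.deg bc
    rw [map_mul, deg_bar T b (Pos.of_mem hb), db, dc, map_add, db] at h
    omega
  have e1 : c * E = β + b * y := by
    linear_combination (-c) * bb + b * bc + sq
  have h1 : T.ip (b * y) c = 1 := by
    rw [ip_mul_left, bc, ip_add_right, T.ip_symm, by0, T.ip_self y hy]; rfl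
  obtain ⟨z, pz, e2⟩ := ((Pos.of_mem hb).mul (Pos.of_mem hy)).peel hc (by omega)
  have dz : T.deg z = 15 := by
    have h := congrArg T.deg e2
    rw [map_mul, map_add, db, dy, dc] at h
    omega
  have nc : T.ip (c * E) (c * E) = 4 := by
    rw [← normE]
    apply ip_congr
    simp only [map_mul]
    linear_combination E * T.bar E * (cc - bb)
  have nz : T.ip z z = 2 ∧ T.ip c z = 0 ∧ T.ip β z = 0 := by
    have h2 := (Pos.of_mem hc).ip_nonneg pz
    have h3 := (Pos.of_mem hβ).ip_nonneg pz
    have h4 := pz.ip_nonneg pz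
    have h5 : T.ip z z ≠ 0 := fun h5 => by
      rw [pz.eq_zero_of_norm h5.le, map_zero] at dz
      omega
    rw [e1, e2, show β + (c + z) = c + (β + z) by ring, ip_add_self, ip_add_self, ip_add_right,
      cβ, T.ip_self c hc, T.ip_self β hβ] at nc
    omega
  obtain ⟨nz, cz, βz⟩ := nz
  obtain ⟨v', hv', w', hw', rfl, v'w'⟩ := pz.of_norm_two nz
  rw [ip_add_right] at cz βz
  have pv' := Pos.of_mem hv'
  have pw' := Pos.of_mem hw'
  have hc' := T.bar_mem c hc
  have dc' := deg_bar T c (Pos.of_mem hc)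
  have e3 : T.bar c * r + T.bar c * s = 2 * c + β + v' + w' := by
    linear_combination (-T.bar c) * csq + c * cc + e1 + e2
  have ncr : T.ip (T.bar c * r) (T.bar c * r) ≤ 2 := by
    obtain ⟨X, pX, e4, X1, -, dX⟩ := exists_mul_bar hr
    rw [dr] at dX
    rw [show T.ip (T.bar c * r) (T.bar c * r) = T.ip (r * T.bar r) (c * T.bar c) from
        ip_congr (by simp only [map_mul, T.bar_bar]; ring), cc, e4, T.ip_add_left,
        ip_add_right, ip_add_right, T.ip_self 1 T.one_mem, X1, T.ip_symm 1 E, E1]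
    have := pX.ip_mul_deg_le hE
    rw [dE, dX] at this
    omega
  have crc : T.ip (T.bar c * r) c = 1 := by
    rw [ip_mul_left, T.bar_bar, csq, ip_add_right, T.ip_self r hr, rs]; rfl
  have csc : T.ip (T.bar c * s) c = 1 := by
    rw [ip_mul_left, T.bar_bar, csq, ip_add_right, T.ip_self s hs, T.ip_symm, rs]; rfl
  obtain ⟨t, pt, cr, ct, nt⟩ := ((Pos.of_mem hc').mul (Pos.of_mem hr)).peel_norm hc
    (by omega) (by omega)
  have dt : T.deg t = 9 := by
    have h := congrArg T.deg cr
    rw [map_mul, dc', dc, dr, map_add, dc] at h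
    omega
  have ht : t ∈ T.B := by
    apply pt.mem_of_norm
    have h2 := pt.ip_nonneg pt
    have h5 : T.ip t t ≠ 0 := fun h5 => by
      rw [pt.eq_zero_of_norm h5.le, map_zero] at dt
      omega
    omega
  obtain ⟨t', pt', cs⟩ := ((Pos.of_mem hc').mul (Pos.of_mem hs)).peel hc (by omega)
  have e5 : t + t' = β + (v' + w') := by linear_combination e3 - cr - cs
  have h6 : T.ip t β = 0 := ip_eq_zero_of_deg ht hβ (by omega)
  have h7 : 1 ≤ T.ip t v' ∨ 1 ≤ T.ip t w' := by
    have h8 := congrArg (T.ip t) e5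
    have h9 := (Pos.of_mem ht).ip_nonneg pt'
    rw [ip_add_right, ip_add_right, ip_add_right, T.ip_self t ht, h6] at h8
    omega
  have dz' : T.deg v' + T.deg w' = 15 := by rw [← map_add]; exact dz
  have cv := (Pos.of_mem hc).ip_nonneg pv'
  have cw := (Pos.of_mem hc).ip_nonneg pw'
  have βv := (Pos.of_mem hβ).ip_nonneg pv'
  have βw := (Pos.of_mem hβ).ip_nonneg pw'
  have cb0' := T.ip_ne c hc _ hb' cb'
  rcases h7 with h7 | h7
  · obtain rfl := eq_of_ip ht hv' h7
    exact ⟨y, t, w', hb, hE, hc, hy, hβ, ht, hw', hr, hs, db, dE, dc, dy, dβ, dt, by omega, dr, ds,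
      barE, bb, cc, sq, csq, bc, by rw [e1, e2]; ring, by rw [e2]; ring, cr,
      by linear_combination cs + e5, by omega, normE, cb0'⟩
  · obtain rfl := eq_of_ip ht hw' h7
    exact ⟨y, t, v', hb, hE, hc, hy, hβ, ht, hv', hr, hs, db, dE, dc, dy, dβ, dt, by omega, dr, ds,
      barE, bb, cc, sq, csq, bc, by rw [e1, e2]; ring, by rw [e2]; ring, cr,
      by linear_combination cs + e5, by omega, normE, cb0'⟩

lemma ip_mul_bar_bar (c x y : R) : T.ip (c * T.bar x) (c * T.bar y) = T.ip (c * x) (c * y) := by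
  rw [T.ip_symm (c * x)]
  apply ip_congr
  simp only [map_mul, T.bar_bar]; ring

lemma ip_bar_mul_mul (c x y : R) : T.ip (T.bar c * x) (T.bar c * y) = T.ip (c * x) (c * y) := by
  apply ip_congr
  simp only [map_mul, T.bar_bar]; ring

lemma ip_mul_bar (c x y : R) : T.ip (c * T.bar x) y = T.ip (c * T.bar y) x := by
  apply ip_congr
  ring

lemma ip_mul (c x y : R) : T.ip (c * x) y = T.ip (T.bar c * y) x := by
  rw [ip_mul_left, T.ip_symm]

/-- A nonnegative element of squared length three containing `x`. -/
lemma Pos.of_norm_three (h : T.Pos a) (hx : x ∈ T.B) (h1 : 1 ≤ T.ip a x) (h2 : T.ip a a = 3) :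
    ∃ y ∈ T.B, ∃ z ∈ T.B, a = x + y + z ∧ T.ip x y = 0 ∧ T.ip x z = 0 ∧ T.ip y z = 0 := by
  obtain ⟨a', pa, rfl, h0, hn⟩ := h.peel_norm hx h1 h2.le
  obtain ⟨y, hy, z, hz, rfl, hyz⟩ := pa.of_norm_two (by omega)
  have h3 := ip_mem_nonneg hx hy
  have h4 := ip_mem_nonneg hx hz
  rw [ip_add_right] at h0
  exact ⟨y, hy, z, hz, by ring, by omega, by omega, hyz⟩

/-- Further products, for `c` times the conjugates of the constituents of `c * E`. -/
structure Config₂ (T : IntTA R) (b E c y β v w r s j k p q ρ σ U W : R) : Prop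
    extends T.Config b E c y β v w r s where
  hj : j ∈ T.B
  hk : k ∈ T.B
  hp : p ∈ T.B
  hq : q ∈ T.B
  pρ : T.Pos ρ
  pσ : T.Pos σ
  pU : T.Pos U
  pW : T.Pos W
  cβ' : c * T.bar β = T.bar b * y
  cβ'_eq : c * T.bar β = E + p + q
  Ep : T.ip E p = 0
  Eq : T.ip E q = 0
  pq : T.ip p q = 0
  p1 : T.ip p 1 = 0
  q1 : T.ip q 1 = 0
  cβ : c * β = s + j + k
  sj : T.ip s j = 0
  sk : T.ip s k = 0
  jk : T.ip j k = 0
  rj : T.ip r j = 0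
  rk : T.ip r k = 0
  djk : T.deg j + T.deg k = 13
  dpq : T.deg p + T.deg q = 10
  rr : r * T.bar r = 1 + E + ρ
  ss : s * T.bar s = 1 + 2 * E + σ
  rs' : T.bar r * s = E + U
  cv' : c * T.bar v = E + ρ + U
  cw' : c * T.bar w = E + W
  rel : T.bar U + σ = p + q + W
  barρ : T.bar ρ = ρ
  barσ : T.bar σ = σ
  ρ1 : T.ip ρ 1 = 0
  σ1 : T.ip σ 1 = 0
  U1 : T.ip U 1 = 0
  W1 : T.ip W 1 = 0
  ρE : T.ip ρ E = 0
  σE : T.ip σ E = 0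
  UE : T.ip U E = 0
  WE : T.ip W E = 0
  dρ : T.deg ρ = 7
  dσ : T.deg σ = 8
  dU : T.deg U = 12
  dW : T.deg W = 10

lemma Config.exists_config₂ {b E c y β v w r s : R} (C : T.Config b E c y β v w r s) :
    ∃ j k p q ρ σ U W, T.Config₂ b E c y β v w r s j k p q ρ σ U W := by
  obtain ⟨hb, hE, hc, hy, hβ, hv, hw, hr, hs, db, dE, dc, dy, dβ, dv, dw, dr, ds, barE, bb, cc,
    sq, csq, bc, cE, bY, cr, cs, βw, normE, cb0'⟩ := C
  have hc' := T.bar_mem c hc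
  have hβ' := T.bar_mem β hβ
  have hv' := T.bar_mem v hv
  have hw' := T.bar_mem w hw
  have pc := Pos.of_mem hc
  have dβ' := deg_bar T β (Pos.of_mem hβ)
  have dv' := deg_bar T v (Pos.of_mem hv)
  have dw' := deg_bar T w (Pos.of_mem hw)
  have E1 := ip_one_of_deg hE (by omega)
  have nE := T.ip_self E hE
  have nβ := T.ip_self β hβ
  have nv := T.ip_self v hv
  have nw := T.ip_self w hw
  have nc := T.ip_self c hc
  have nr := T.ip_self r hr
  have ns := T.ip_self s hs
  have n1 := T.ip_self 1 T.one_mem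
  have icβ := ip_eq_zero_of_deg hc hβ (by omega)
  have icv := ip_eq_zero_of_deg hc hv (by omega)
  have icw := ip_eq_zero_of_deg hc hw (by omega)
  have iβv := ip_eq_zero_of_deg hβ hv (by omega)
  have ivw := ip_eq_zero_of_deg hv hw (by omega)
  have ivβ := ip_eq_zero_of_deg hv hβ (by omega)
  have iwv := ip_eq_zero_of_deg hw hv (by omega)
  have iwβ : T.ip w β = 0 := by rw [T.ip_symm, βw]
  have irs := ip_eq_zero_of_deg hr hs (by omega)
  have ibβ := ip_eq_zero_of_deg hb hβ (by omega)
  have cβ' : c * T.bar β = T.bar b * y := by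
    have h := congrArg T.bar sq
    rw [map_mul, map_add] at h
    linear_combination T.bar b * bc - c * h - cc + bb
  have ncβ : T.ip (c * β) (c * β) = 3 := by
    rw [← ip_mul_bar_bar, cβ', ip_bar_mul_mul, bY, add_assoc, ip_add_self, ip_add_self,
      ip_add_right]
    omega
  have cβE : T.ip (c * T.bar β) E = 1 := by
    rw [ip_mul_bar, barE, cE]; simp only [T.ip_add_left]; omega
  have cvE : T.ip (c * T.bar v) E = 1 := by
    rw [ip_mul_bar, barE, cE]; simp only [T.ip_add_left]; omega
  have cwE : T.ip (c * T.bar w) E = 1 := by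
    rw [ip_mul_bar, barE, cE]; simp only [T.ip_add_left]; omega
  have cx1 : ∀ x, T.ip (c * T.bar x) 1 = T.ip c x := fun x => by
    rw [ip_mul_bar, bar_one, mul_one]
  have cβs : T.ip (c * β) s = 1 := by
    rw [ip_mul, cs]; simp only [T.ip_add_left]; omega
  have cβr : T.ip (c * β) r = 0 := by
    rw [ip_mul, cr]; simp only [T.ip_add_left]; omega
  obtain ⟨j, hj, k, hk, cβ, sj, sk, jk⟩ := (pc.mul (Pos.of_mem hβ)).of_norm_three hs
    (by omega) ncβ
  obtain ⟨p, hp, q, hq, cβ'_eq, Ep, Eq, pq⟩ := (pc.mul (Pos.of_mem hβ')).of_norm_three hE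
    (by omega) (by rw [ip_mul_bar_bar, ncβ])
  have dcβ := congrArg T.deg cβ
  have dcβ' := congrArg T.deg cβ'_eq
  simp only [map_mul, map_add] at dcβ dcβ'
  rw [dc, dβ] at dcβ
  rw [dc, dβ', dβ] at dcβ'
  have cβ1 := cx1 β
  rw [cβ'_eq] at cβ1
  simp only [T.ip_add_left] at cβ1
  have ip1 := ip_mem_nonneg hp T.one_mem
  have iq1 := ip_mem_nonneg hq T.one_mem
  rw [cβ] at cβr
  simp only [T.ip_add_left] at cβr
  have ijr := ip_mem_nonneg hj hr
  have ikr := ip_mem_nonneg hk hr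
  have isr := T.ip_symm s r
  have key : ∀ u, T.ip (T.bar c * u) (T.bar c * u) = T.ip u u + T.ip (u * T.bar u) E := by
    intro u
    rw [ip_bar_mul_mul, ip_mul_mul cc]
    congr 1
    rw [T.ip_symm (u * T.bar u)]
    exact ip_congr (by simp only [map_mul, T.bar_bar]; ring)
  have rrE : T.ip (r * T.bar r) E = 1 := by
    have h := key r
    rw [cr, ip_add_self] at h
    omega
  have ssE : T.ip (s * T.bar s) E = 2 := by
    have h := key s
    rw [cs, add_assoc, ip_add_self, ip_add_self, ip_add_right] at h
    omega
  obtain ⟨X, pX, hX, X1, -, dX⟩ := exists_mul_bar hr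
  obtain ⟨Y, pY, hY, Y1, -, dY⟩ := exists_mul_bar hs
  have i1E := T.ip_symm 1 E
  rw [hX, T.ip_add_left] at rrE
  rw [hY, T.ip_add_left] at ssE
  obtain ⟨ρ, pρ, rfl⟩ := pX.peel hE (by omega)
  obtain ⟨σ', pσ', rfl⟩ := pY.peel hE (by omega)
  rw [T.ip_add_left] at rrE ssE X1 Y1
  obtain ⟨σ, pσ, rfl⟩ := pσ'.peel hE (by omega)
  rw [T.ip_add_left] at ssE Y1
  rw [map_add] at dX dY
  rw [map_add] at dY
  rw [dr, dE] at dX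
  rw [ds, dE] at dY
  have hrb : r * T.bar r = T.bar r * r := mul_comm _ _
  have cv_rs : c * T.bar v = ρ + T.bar r * s := by
    have h := congrArg T.bar cr
    rw [map_mul, map_add, T.bar_bar] at h
    linear_combination T.bar r * csq - c * h + hX - cc
  have rsE : T.ip (T.bar r * s) E = 1 := by
    rw [cv_rs, T.ip_add_left] at cvE; omega
  obtain ⟨U, pU, rs'⟩ := ((Pos.of_mem (T.bar_mem r hr)).mul (Pos.of_mem hs)).peel hE (by omega)
  have rs1 : T.ip (T.bar r * s) 1 = 0 := by
    rw [ip_mul_left, T.bar_bar, mul_one, T.ip_symm, irs]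
  have drs := congrArg T.deg rs'
  rw [map_mul, deg_bar T r (Pos.of_mem hr), map_add, dr, ds, dE] at drs
  rw [rs', T.ip_add_left] at rs1 rsE
  obtain ⟨W, pW, cw'⟩ := (pc.mul (Pos.of_mem hw')).peel hE (by omega)
  have cw1 := cx1 w
  rw [cw', T.ip_add_left] at cw1 cwE
  have dcw := congrArg T.deg cw'
  rw [map_mul, map_add, dc, dw', dw, dE] at dcw
  refine ⟨j, k, p, q, ρ, σ, U, W,
    { hb := hb, hE := hE, hc := hc, hy := hy, hβ := hβ, hv := hv, hw := hw, hr := hr, hs := hs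
      db := db, dE := dE, dc := dc, dy := dy, dβ := dβ, dv := dv, dw := dw, dr := dr, ds := ds
      barE := barE, bb := bb, cc := cc, sq := sq, csq := csq, bc := bc, cE := cE, bY := bY
      cr := cr, cs := cs, βw := βw, normE := normE, cb' := cb0'
      hj := hj, hk := hk, hp := hp, hq := hq, pρ := pρ, pσ := pσ, pU := pU, pW := pW
      cβ' := cβ', cβ'_eq := cβ'_eq, Ep := Ep, Eq := Eq, pq := pq
      p1 := by omega, q1 := by omega, cβ := cβ, sj := sj, sk := sk, jk := jk
      rj := by rw [T.ip_symm]; omega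
      rk := by rw [T.ip_symm]; omega
      djk := by omega
      dpq := by omega
      rr := by rw [hX]; ring
      ss := by rw [hY]; ring
      rs' := rs'
      cv' := by rw [cv_rs, rs']; ring
      cw' := cw'
      rel := ?_
      barρ := ?_
      barσ := ?_
      ρ1 := by omega
      σ1 := by omega
      U1 := by omega
      W1 := by omega
      ρE := by omega
      σE := by omega
      UE := by omega
      WE := by omega
      dρ := by omega
      dσ := by omega
      dU := by omega
      dW := by omega }⟩
  · have h := congrArg T.bar cs
    have h' := congrArg T.bar rs'
    rw [map_mul, map_add, map_add, T.bar_bar] at h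
    rw [map_mul, map_add, T.bar_bar, barE] at h'
    linear_combination c * h - T.bar s * csq + cc + cβ'_eq + cw' - hY - h'
  · have h := congrArg T.bar hX
    simp only [map_mul, map_add, T.bar_bar, map_one, barE] at h
    linear_combination hX - h
  · have h := congrArg T.bar hY
    simp only [map_mul, map_add, T.bar_bar, map_one, barE] at h
    linear_combination hY - h

lemma Config₂.swap_pq {b E c y β v w r s j k p q ρ σ U W : R}
    (C : T.Config₂ b E c y β v w r s j k p q ρ σ U W) :
    T.Config₂ b E c y β v w r s j k q p ρ σ U W :=
  { C with
    hp := C.hq, hq := C.hp, Ep := C.Eq, Eq := C.Ep, p1 := C.q1, q1 := C.p1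
    pq := by rw [T.ip_symm, C.pq]
    cβ'_eq := by rw [C.cβ'_eq]; ring
    dpq := by rw [add_comm, C.dpq]
    rel := by rw [C.rel]; ring }

lemma Config₂.swap_jk {b E c y β v w r s j k p q ρ σ U W : R}
    (C : T.Config₂ b E c y β v w r s j k p q ρ σ U W) :
    T.Config₂ b E c y β v w r s k j p q ρ σ U W :=
  { C with
    hj := C.hk, hk := C.hj, sj := C.sk, sk := C.sj, rj := C.rk, rk := C.rj
    jk := by rw [T.ip_symm, C.jk]
    cβ := by rw [C.cβ]; ring
    djk := by rw [add_comm, C.djk] }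

lemma Config.ip_cv_r {b E c y β v w r s : R} (C : T.Config b E c y β v w r s) :
    T.ip (c * v) r = 1 := by
  have := ip_eq_zero_of_deg C.hc C.hv (by rw [C.dc, C.dv]; decide)
  rw [ip_mul, C.cr, T.ip_add_left, T.ip_self v C.hv]; omega

lemma Config.ip_cv_s {b E c y β v w r s : R} (C : T.Config b E c y β v w r s) :
    T.ip (c * v) s = 0 := by
  have := ip_eq_zero_of_deg C.hc C.hv (by rw [C.dc, C.dv]; decide)
  have := ip_eq_zero_of_deg C.hβ C.hv (by rw [C.dβ, C.dv]; decide)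
  have := ip_eq_zero_of_deg C.hw C.hv (by rw [C.dw, C.dv]; decide)
  rw [ip_mul, C.cs, T.ip_add_left, T.ip_add_left]; omega

lemma Config.ip_cw_r {b E c y β v w r s : R} (C : T.Config b E c y β v w r s) :
    T.ip (c * w) r = 0 := by
  have := ip_eq_zero_of_deg C.hc C.hw (by rw [C.dc, C.dw]; decide)
  have := ip_eq_zero_of_deg C.hv C.hw (by rw [C.dv, C.dw]; decide)
  rw [ip_mul, C.cr, T.ip_add_left]; omega

lemma Config.ip_cw_s {b E c y β v w r s : R} (C : T.Config b E c y β v w r s) :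
    T.ip (c * w) s = 1 := by
  have := ip_eq_zero_of_deg C.hc C.hw (by rw [C.dc, C.dw]; decide)
  have := C.βw
  have := T.ip_self w C.hw
  rw [ip_mul, C.cs, T.ip_add_left, T.ip_add_left]; omega

lemma mul_deg_bar {c x : R} (hx : x ∈ T.B) : T.deg (c * T.bar x) = T.deg c * T.deg x := by
  rw [map_mul, deg_bar T x (Pos.of_mem hx)]

lemma bar_mul_deg {c x : R} (hc : c ∈ T.B) : T.deg (T.bar c * x) = T.deg c * T.deg x := by
  rw [map_mul, deg_bar T c (Pos.of_mem hc)]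

/-- The configuration to which most of the cases reduce. -/
lemma Config₂.terminal {b E c y β v w r s j k p q ρ σ U W x y' : R}
    (C : T.Config₂ b E c y β v w r s j k p q ρ σ U W) (hx : x ∈ T.B) (hy' : y' ∈ T.B)
    (dp : T.deg p = 6) (dq : T.deg q = 4) (dx : T.deg x = 6) (dy' : T.deg y' = 4)
    (hW : W = x + y') (hσ : σ = q + y') (hvp : 1 ≤ T.ip (c * T.bar v) p)
    (hvx : 1 ≤ T.ip (c * T.bar v) x) : False := by
  have hp := C.hp
  have hq := C.hq
  have pc := Pos.of_mem C.hc
  have pc' := pc.bar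
  have cw' := C.cw'
  rw [hW, ← add_assoc] at cw'
  have nE := T.ip_self E C.hE
  have np := T.ip_self p hp
  have nq := T.ip_self q hq
  have nx := T.ip_self x hx
  have ny' := T.ip_self y' hy'
  have ns := T.ip_self s C.hs
  have nr := T.ip_self r C.hr
  have dE := C.dE
  have ds := C.ds
  have dr := C.dr
  have dc := C.dc
  have dβ := C.dβ
  have dv := C.dv
  have dw := C.dw
  have dρ := C.dρ
  have Ep := C.Ep
  have Eq := C.Eq
  have pq := C.pq
  have qp := T.ip_symm q p
  have iEx := ip_eq_zero_of_deg C.hE hx (by omega)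
  have iEy' := ip_eq_zero_of_deg C.hE hy' (by omega)
  have ipE := ip_eq_zero_of_deg hp C.hE (by omega)
  have iqE := ip_eq_zero_of_deg hq C.hE (by omega)
  have ixE := ip_eq_zero_of_deg hx C.hE (by omega)
  have ixy' := ip_eq_zero_of_deg hx hy' (by omega)
  have ixq := ip_eq_zero_of_deg hx hq (by omega)
  have iqx := ip_eq_zero_of_deg hq hx (by omega)
  have ipy' := ip_eq_zero_of_deg hp hy' (by omega)
  have iy'x := ip_eq_zero_of_deg hy' hx (by omega)
  have iρE := C.ρE
  have iρp := C.pρ.ip_eq_zero_of_deg_seven C.ρ1 dρ hp (by omega)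
  have iρx := C.pρ.ip_eq_zero_of_deg_seven C.ρ1 dρ hx (by omega)
  have iρq := C.pρ.ip_nonneg (Pos.of_mem hq)
  have iρy' := C.pρ.ip_nonneg (Pos.of_mem hy')
  have ipx : T.ip p x = 0 := by
    by_contra h
    obtain rfl : p = x := eq_of_ip hp hx (by have := ip_mem_nonneg hp hx; omega)
    have h := (pc.mul (Pos.of_mem (T.bar_mem p hp))).deg_three C.hβ C.hv C.hw
      (ip_eq_zero_of_deg C.hβ C.hv (by omega)) C.βw (ip_eq_zero_of_deg C.hv C.hw (by omega))
      (by rw [ip_mul_bar, C.cβ'_eq]; simp only [T.ip_add_left]; omega)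
      (by rw [ip_mul_bar]; omega)
      (by rw [ip_mul_bar, cw']; simp only [T.ip_add_left]; omega)
    rw [mul_deg_bar hp] at h
    rw [dc, dβ, dv, dw, dp] at h
    omega
  have ixp := T.ip_symm x p
  have hU : U = p + x := by
    rw [C.cv', T.ip_add_left, T.ip_add_left] at hvp hvx
    obtain ⟨U', pU', e⟩ := C.pU.peel_two hp hx ipx (by omega) (by omega)
    have h := congrArg T.deg e
    rw [map_add, map_add, C.dU, dp, dx] at h
    rw [e, pU'.eq_zero_of_deg (by omega), add_zero]
  have cv' := C.cv'
  rw [hU, ← add_assoc] at cv'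
  have nρ := C.pρ.ip_le_two_of_deg_seven C.ρ1 dρ C.pρ dρ
  have iEρ := T.ip_symm E ρ
  have ipρ := T.ip_symm p ρ
  have ixρ := T.ip_symm x ρ
  have ncv : T.ip (c * v) (c * v) ≤ 5 := by
    rw [← ip_mul_bar_bar, cv']
    simp only [T.ip_add_left, ip_add_right]
    omega
  have hcv := pc.mul (Pos.of_mem C.hv)
  have cvr := C.ip_cv_r
  have cvs := C.ip_cv_s
  obtain ⟨a0, pa0, e0⟩ := hcv.peel C.hr cvr.ge
  have da0 : T.deg a0 = 23 := by
    have h := congrArg T.deg e0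
    rw [map_mul, map_add, dc, dv, dr] at h
    omega
  have mult : ∀ m ∈ T.B, T.ip (c * v) m ≤ 1 := by
    intro m hm
    by_contra h
    have irm : T.ip r m = 0 := by
      rcases ip_mem C.hr hm with ⟨h', -⟩ | ⟨-, rfl⟩
      · exact h'
      · omega
    rw [e0, T.ip_add_left] at h
    obtain ⟨a1, pa1, e1⟩ := pa0.peel hm (by omega)
    have nm := T.ip_self m hm
    rw [e1, T.ip_add_left] at h
    obtain ⟨a2, pa2, e2⟩ := pa1.peel hm (by omega)
    have h1 := (Pos.of_mem C.hr).ip_nonneg pa2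
    have h2 := (Pos.of_mem hm).ip_nonneg pa2
    rw [e0, e1, e2, ip_add_self, ip_add_self, ip_add_self] at ncv
    simp only [ip_add_right] at ncv
    have h3 := pa2.eq_zero_of_norm (by omega)
    rw [e1, e2, h3, add_zero, map_add] at da0
    omega
  have hcw := pc.mul (Pos.of_mem C.hw)
  have cwr := C.ip_cw_r
  have cws := C.ip_cw_s
  have ncw : T.ip (c * w) (c * w) = 3 := by
    rw [← ip_mul_bar_bar, cw', add_assoc, ip_add_self, ip_add_self, ip_add_right]
    omega
  obtain ⟨j', hj', k', hk', cw, sj', sk', jk'⟩ := hcw.of_norm_three C.hs cws.ge ncw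
  have djk' : T.deg j' + T.deg k' = 13 := by
    have h := congrArg T.deg cw
    rw [map_mul, map_add, map_add, dc, dw, ds] at h
    omega
  have hj := C.hj
  have hk := C.hk
  have cvβ : 2 ≤ T.ip (c * v) (c * β) := by
    rw [← ip_mul_bar_bar, cv', C.cβ'_eq]
    simp only [T.ip_add_left, ip_add_right]
    omega
  have cvw : 2 ≤ T.ip (c * v) (c * w) := by
    rw [← ip_mul_bar_bar, cv', cw']
    simp only [T.ip_add_left, ip_add_right]
    omega
  rw [C.cβ] at cvβ
  rw [cw] at cvw
  rw [ip_add_right, ip_add_right] at cvβ cvw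
  have mj := mult j hj
  have mk := mult k hk
  have mj' := mult j' hj'
  have mk' := mult k' hk'
  have ijj := ip_mem_nonneg hj hj'
  have ijk := ip_mem_nonneg hj hk'
  have ikj := ip_mem_nonneg hk hj'
  have ikk := ip_mem_nonneg hk hk'
  have irj := C.rj
  have irk := C.rk
  have irj' : T.ip r j' = 0 ∧ T.ip r k' = 0 := by
    rw [cw] at cwr
    simp only [T.ip_add_left] at cwr
    have := ip_mem_nonneg C.hs C.hr
    have := ip_mem_nonneg hj' C.hr
    have := ip_mem_nonneg hk' C.hr
    rw [T.ip_symm r, T.ip_symm r]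
    omega
  have inner : T.ip (c * β) (c * w) = 1 + T.ip q y' := by
    rw [← ip_mul_bar_bar, C.cβ'_eq, cw']
    simp only [T.ip_add_left, ip_add_right]
    omega
  rcases ip_mem hq hy' with ⟨h, -⟩ | ⟨-, rfl⟩
  · rw [C.cβ, cw] at inner
    simp only [T.ip_add_left, ip_add_right] at inner
    have := ip_mem_nonneg hj C.hs
    have := ip_mem_nonneg hk C.hs
    rw [e0, T.ip_add_left] at mj mk mj' mk'
    rw [e0] at cvβ cvw
    simp only [T.ip_add_left] at cvβ cvw
    have irs := ip_eq_zero_of_deg C.hr C.hs (by omega)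
    have ia := pa0.ip_nonneg (Pos.of_mem C.hs)
    rw [e0, T.ip_add_left] at cvs
    obtain ⟨a1, pa1, e1⟩ := pa0.peel_two hj hk C.jk (by omega) (by omega)
    rw [e1] at cvw cvs
    simp only [T.ip_add_left] at cvw cvs
    rw [e1] at mj' mk' da0
    simp only [T.ip_add_left] at mj' mk'
    have := C.djk
    have := pa1.ip_nonneg (Pos.of_mem C.hs)
    have hd := pa1.deg_two hj' hk' jk' (by omega) (by omega)
    rw [map_add, map_add] at da0
    omega
  · have hσ' : σ = 2 * q := by rw [hσ]; ring
    have qbar : T.bar q = q := by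
      have h := C.barσ
      rw [hσ', map_mul, map_ofNat] at h
      have h' := congrArg (fun z => T.ip z q) h
      simp only [ip_two_mul_left] at h'
      exact eq_of_ip (T.bar_mem q hq) hq (by omega)
    have hcq := pc.mul (Pos.of_mem hq)
    have cqβ : T.ip (c * q) β = 1 := by
      rw [← qbar, ip_mul_bar, C.cβ'_eq]; simp only [T.ip_add_left]; omega
    have cqw : T.ip (c * q) w = 1 := by
      rw [← qbar, ip_mul_bar, cw']; simp only [T.ip_add_left]; omega
    have nβ := T.ip_self β C.hβ
    have nw := T.ip_self w C.hw
    have iβw := C.βw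
    have cq : c * q = β + w := by
      obtain ⟨z, pz, e⟩ := hcq.peel_two C.hβ C.hw C.βw cqβ.ge cqw.ge
      have h := congrArg T.deg e
      rw [map_mul, map_add, map_add, dc, dq, dβ, dw] at h
      rw [e, pz.eq_zero_of_deg (by omega), add_zero]
    obtain ⟨X, pX, eX, X1, -, dX⟩ := exists_mul_bar hq
    have XE : T.ip X E = 1 := by
      have h : T.ip (c * q) (c * q) = 2 := by
        rw [cq, ip_add_self]; omega
      rw [show T.ip (c * q) (c * q) = T.ip (q * T.bar q) (c * T.bar c) from
        ip_congr (by simp only [map_mul, T.bar_bar]; ring), eX, C.cc] at h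
      simp only [T.ip_add_left, ip_add_right] at h
      have := T.ip_self 1 T.one_mem
      have := ip_one_of_deg C.hE (by omega)
      have := T.ip_symm 1 E
      omega
    obtain ⟨Q, pQ, rfl⟩ := pX.peel C.hE XE.ge
    rw [map_add] at dX
    rw [dq, dE] at dX
    rw [T.ip_add_left] at XE X1
    have iqQ := pQ.ip_mul_deg_le hq
    rw [dq] at iqQ
    have i1Q := (Pos.of_mem T.one_mem).ip_nonneg pQ
    have ss := C.ss
    rw [hσ'] at ss
    have sqs : T.ip (s * q) s = 2 := by
      rw [ip_mul, mul_comm, ss]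
      simp only [T.ip_add_left, ip_two_mul_left]
      have := T.ip_symm 1 q
      have := C.q1
      omega
    have nsq : T.ip (s * q) (s * q) ≤ 5 := by
      rw [show T.ip (s * q) (s * q) = T.ip (s * T.bar s) (q * T.bar q) from
        ip_congr (by simp only [map_mul, T.bar_bar]; ring), eX, ss]
      simp only [T.ip_add_left, ip_add_right, ip_two_mul_left]
      have := T.ip_self 1 T.one_mem
      have := ip_one_of_deg C.hE (by omega)
      have := T.ip_symm 1 E
      have := T.ip_symm 1 Q
      have := T.ip_symm E Q
      have := T.ip_symm q Q
      have := C.q1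
      omega
    obtain ⟨t1, pt1, e1⟩ := ((Pos.of_mem C.hs).mul (Pos.of_mem hq)).peel C.hs (by omega)
    rw [e1, T.ip_add_left] at sqs
    obtain ⟨t, pt, rfl⟩ := pt1.peel C.hs (by omega)
    have dt : T.deg t = 10 := by
      have h := congrArg T.deg e1
      rw [map_mul, map_add, map_add, ds, dq] at h
      omega
    have ht : t ∈ T.B := by
      apply pt.mem_of_norm
      have h := (Pos.of_mem C.hs).ip_nonneg pt
      have h1 := pt.ip_nonneg pt
      have h2 : T.ip t t ≠ 0 := fun h2 => by
        rw [pt.eq_zero_of_norm h2.le, map_zero] at dt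
        omega
      rw [e1, ip_add_self, ip_add_self, ip_add_right] at nsq
      omega
    have e2 : r * q + t = j + k + j' + k' := by
      linear_combination (-q) * C.csq + c * cq + C.cβ + cw - e1
    have h := congrArg (fun z => T.ip z t) e2
    simp only [T.ip_add_left] at h
    have h1 := ((Pos.of_mem C.hr).mul (Pos.of_mem hq)).ip_nonneg (Pos.of_mem ht)
    rw [T.ip_self t ht] at h
    have low : ∀ m ∈ T.B, T.ip (c * v) m = 1 → 1 ≤ T.ip (c * β) m ∨ 1 ≤ T.ip (c * w) m →
        5 ≤ T.deg m := by
      intro m hm h1 h2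
      rw [ip_mul] at h1 h2
      rw [ip_mul c w] at h2
      have hm' := pc'.mul (Pos.of_mem hm)
      rcases h2 with h2 | h2
      · have h3 := hm'.deg_two C.hv C.hβ (ip_eq_zero_of_deg C.hv C.hβ (by omega)) h1.ge h2
        rw [bar_mul_deg C.hc] at h3
        rw [dc, dv, dβ] at h3
        omega
      · have h3 := hm'.deg_two C.hv C.hw (ip_eq_zero_of_deg C.hv C.hw (by omega)) h1.ge h2
        rw [bar_mul_deg C.hc] at h3
        rw [dc, dv, dw] at h3
        omega
    have isj := C.sj
    have isk := C.sk
    have ijk0 := C.jk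
    have ikj0 := T.ip_symm k j
    have lj := low j hj (by omega) (Or.inl (by
      rw [C.cβ]; simp only [T.ip_add_left]; rw [T.ip_self j hj]; omega))
    have lk := low k hk (by omega) (Or.inl (by
      rw [C.cβ]; simp only [T.ip_add_left]; rw [T.ip_self k hk]; omega))
    have ikj0' := T.ip_symm k' j'
    have lj' := low j' hj' (by omega) (Or.inr (by
      rw [cw]; simp only [T.ip_add_left]; rw [T.ip_self j' hj']; omega))
    have lk' := low k' hk' (by omega) (Or.inr (by
      rw [cw]; simp only [T.ip_add_left]; rw [T.ip_self k' hk']; omega))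
    have djk := C.djk
    rw [ip_eq_zero_of_deg hj ht (by omega), ip_eq_zero_of_deg hk ht (by omega),
      ip_eq_zero_of_deg hj' ht (by omega), ip_eq_zero_of_deg hk' ht (by omega)] at h
    omega

lemma ip_mul_self (x u : R) : T.ip (x * u) (x * u) = T.ip (x * T.bar x) (u * T.bar u) :=
  ip_congr (by simp only [map_mul, T.bar_bar]; ring)

lemma Config.norm_bar_mul {b E c y β v w r s : R} (C : T.Config b E c y β v w r s)
    (hu : u ∈ T.B) : ∃ X, T.Pos X ∧ u * T.bar u = 1 + X ∧ T.ip X 1 = 0 ∧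
      T.deg X = T.deg u * T.deg u - 1 ∧ T.ip (T.bar b * u) (T.bar b * u) = 1 + T.ip X E := by
  obtain ⟨X, pX, eX, X1, -, dX⟩ := exists_mul_bar hu
  refine ⟨X, pX, eX, X1, dX, ?_⟩
  have h1 := T.ip_self 1 T.one_mem
  have h2 := ip_one_of_deg C.hE (by rw [C.dE]; decide)
  have h3 := T.ip_symm 1 X
  have h4 := T.ip_symm E X
  rw [ip_bar_mul_mul, ip_mul_self, C.bb, eX]
  simp only [T.ip_add_left, ip_add_right]
  omega

lemma Config.norm_b_eq_c {b E c y β v w r s : R} (C : T.Config b E c y β v w r s) (u : R) :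
    T.ip (T.bar b * u) (T.bar b * u) = T.ip (T.bar c * u) (T.bar c * u) := by
  rw [ip_bar_mul_mul, ip_bar_mul_mul, ip_mul_self, C.bb, ip_mul_self, C.cc]

/-- The product `b * c` and its interaction with `s`. -/
structure Config₃ (T : IntTA R) (b E c y β v w r s j k p q ρ σ U W d e f : R) : Prop
    extends T.Config₂ b E c y β v w r s j k p q ρ σ U W where
  hd : d ∈ T.B
  he : e ∈ T.B
  hf : f ∈ T.B
  de : T.ip d e = 0
  d1 : T.ip d 1 = 0
  e1 : T.ip e 1 = 0
  dde : T.deg d + T.deg e = 9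
  dle : T.deg d ≤ T.deg e
  df : T.deg f = 6
  bc' : b * c = d + e
  bs : T.bar b * s = d + e + f
  bd_s : T.ip (b * d) s = 1
  be_s : T.ip (b * e) s = 1
  bd_c : T.ip (T.bar b * d) c = 1
  cd_b : T.ip (T.bar c * d) b = 1
  hbde : b * d + b * e = r + 2 * s + j + k
  hbde' : T.bar b * d + T.bar b * e = 2 * c + β + v + w
  hcde : T.bar c * d + T.bar c * e = b + b * E

lemma Config₃.swap_jk {b E c y β v w r s j k p q ρ σ U W d e f : R}
    (C : T.Config₃ b E c y β v w r s j k p q ρ σ U W d e f) :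
    T.Config₃ b E c y β v w r s k j p q ρ σ U W d e f :=
  { C with
    toConfig₂ := C.toConfig₂.swap_jk
    hbde := by rw [C.hbde]; ring }

lemma Config₂.exists_config₃ {b E c y β v w r s j k p q ρ σ U W : R}
    (C : T.Config₂ b E c y β v w r s j k p q ρ σ U W) :
    ∃ d e f, T.Config₃ b E c y β v w r s j k p q ρ σ U W d e f := by
  have pb := Pos.of_mem C.hb
  have db := C.db
  have dc := C.dc
  have nb := T.ip_self b C.hb
  have nc := T.ip_self c C.hc
  have ns := T.ip_self s C.hs
  have iby := ip_eq_zero_of_deg C.hb C.hy (by rw [C.db, C.dy]; decide)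
  have icβ := ip_eq_zero_of_deg C.hc C.hβ (by rw [C.dc, C.dβ]; decide)
  have icw := ip_eq_zero_of_deg C.hc C.hw (by rw [C.dc, C.dw]; decide)
  have irs := ip_eq_zero_of_deg C.hr C.hs (by rw [C.dr, C.ds]; decide)
  have nbc : T.ip (b * c) (b * c) = 2 := by
    rw [← ip_bar_mul_mul, C.bc, ip_add_self, nb, T.ip_self y C.hy, iby]; rfl
  obtain ⟨d, hd, e, he, bc', de⟩ := (pb.mul (Pos.of_mem C.hc)).of_norm_two nbc
  have hbde : b * d + b * e = r + 2 * s + j + k := by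
    linear_combination (-b) * bc' + c * C.sq + C.csq + C.cβ
  have hbde' : T.bar b * d + T.bar b * e = 2 * c + β + v + w := by
    linear_combination (-T.bar b) * bc' + c * C.bb + C.cE
  have hcde : T.bar c * d + T.bar c * e = b + b * E := by
    linear_combination (-T.bar c) * bc' + b * C.cc
  have h1 : T.ip (b * c) 1 = 0 := by
    rw [ip_mul_left, mul_one, C.cb']
  rw [bc', T.ip_add_left] at h1
  have d1 := ip_mem_nonneg hd T.one_mem
  have e1 := ip_mem_nonneg he T.one_mem
  have dde : T.deg d + T.deg e = 9 := by
    have h := congrArg T.deg bc'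
    rw [map_mul, map_add, db, dc] at h
    omega
  have nbs : T.ip (T.bar b * s) (T.bar b * s) = 3 := by
    rw [C.norm_b_eq_c, C.cs]
    simp only [add_assoc]
    rw [ip_add_self, ip_add_self, nc, T.ip_self β C.hβ, T.ip_self w C.hw, ip_add_right, icβ, icw,
      C.βw]
    rfl
  have hbs := pb.bar.mul (Pos.of_mem C.hs)
  have le_one : ∀ x ∈ T.B, T.ip (T.bar b * s) x ≤ 1 := by
    intro x hx
    by_contra h
    obtain ⟨a', -, e', h0, -⟩ := hbs.peel_norm hx (by omega) nbs.le
    rw [e', T.ip_add_left, T.ip_self x hx, T.ip_symm] at h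
    omega
  have hsum : T.ip (b * d) s + T.ip (b * e) s = 2 := by
    rw [← T.ip_add_left, hbde]
    simp only [T.ip_add_left, ip_two_mul_left]
    rw [T.ip_symm j, T.ip_symm k, C.sj, C.sk]
    omega
  rw [ip_mul, ip_mul b e] at hsum
  have ld := le_one d hd
  have le := le_one e he
  obtain ⟨f, pf, bs⟩ := hbs.peel_two hd he de (by omega) (by omega)
  have df : T.deg f = 6 := by
    have h := congrArg T.deg bs
    rw [bar_mul_deg C.hb, map_add, map_add, db, C.ds] at h
    omega
  have hf : f ∈ T.B := by
    apply pf.mem_of_norm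
    have h1 := pf.ip_nonneg pf
    have h2 := (Pos.of_mem hd).ip_nonneg pf
    have h3 := (Pos.of_mem he).ip_nonneg pf
    have h0 : T.ip f f ≠ 0 := fun h0 => by
      rw [pf.eq_zero_of_norm h0.le, map_zero] at df
      omega
    rw [bs, add_assoc, ip_add_self, ip_add_self, ip_add_right, T.ip_self d hd,
      T.ip_self e he] at nbs
    omega
  have ide := T.ip_symm e d
  have nd := T.ip_self d hd
  have ne := T.ip_self e he
  have bxc : ∀ x, T.ip (T.bar b * x) c = T.ip (d + e) x := by
    intro x
    rw [ip_mul_left, T.bar_bar, bc', T.ip_symm]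
  have cxb : ∀ x, T.ip (T.bar c * x) b = T.ip (d + e) x := by
    intro x
    rw [ip_mul_left, T.bar_bar, mul_comm, bc', T.ip_symm]
  have hbdc := bxc d
  have hbec := bxc e
  have hcdb := cxb d
  have hceb := cxb e
  rw [T.ip_add_left] at hbdc hbec hcdb hceb
  have hbds := ip_mul (T := T) b d s
  have hbes := ip_mul (T := T) b e s
  rcases le_total (T.deg d) (T.deg e) with hle | hle
  · exact ⟨d, e, f, { C with
      hd := hd, he := he, hf := hf, de := de, d1 := by omega, e1 := by omega, dde := dde
      dle := hle, df := df, bc' := bc', bs := bs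
      bd_s := by omega
      be_s := by omega
      bd_c := by omega
      cd_b := by omega
      hbde := hbde, hbde' := hbde', hcde := hcde }⟩
  · exact ⟨e, d, f, { C with
      hd := he, he := hd, hf := hf, de := ide.trans de, d1 := by omega, e1 := by omega
      dde := by omega
      dle := hle, df := df, bc' := by rw [bc']; ring
      bs := by rw [bs]; ring
      bd_s := by omega
      be_s := by omega
      bd_c := by omega
      cd_b := by omega
      hbde := by rw [add_comm, hbde]
      hbde' := by rw [add_comm, hbde']
      hcde := by rw [add_comm, hcde] }⟩

/-- `bar b * d` is `c` plus one of `β`, `v`, `w` as soon as its squared length is at most two. -/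
lemma Config₃.bar_b_mul_d {b E c y β v w r s j k p q ρ σ U W d e f : R}
    (C : T.Config₃ b E c y β v w r s j k p q ρ σ U W d e f)
    (hn : T.ip (T.bar b * d) (T.bar b * d) ≤ 2) :
    ∃ z ∈ T.B, T.bar b * d = c + z ∧ T.ip c z = 0 ∧ T.deg z = 3 * T.deg d - 3 ∧
      (z = β ∨ z = v ∨ z = w) := by
  have h3 := three_le_deg C.hd C.d1
  have hbc := C.bd_c
  have pb := Pos.of_mem C.hb
  obtain ⟨z, pz, ez, cz, nz⟩ := (pb.bar.mul (Pos.of_mem C.hd)).peel_norm C.hc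
    (by omega) (by omega)
  have dz : T.deg z = 3 * T.deg d - 3 := by
    have h := congrArg T.deg ez
    rw [bar_mul_deg C.hb, map_add, C.db, C.dc] at h
    omega
  have hz : z ∈ T.B := by
    apply pz.mem_of_norm
    have h1 := pz.ip_nonneg pz
    have h0 : T.ip z z ≠ 0 := fun h0 => by
      rw [pz.eq_zero_of_norm h0.le, map_zero] at dz
      omega
    omega
  refine ⟨z, hz, ez, cz, dz, ?_⟩
  have h := congrArg (fun x => T.ip x z) C.hbde'
  rw [ez] at h
  simp only [T.ip_add_left, ip_two_mul_left] at h
  rw [T.ip_self z hz, cz] at h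
  have h1 := (pb.bar.mul (Pos.of_mem C.he)).ip_nonneg pz
  rcases ip_mem C.hβ hz with h2 | ⟨-, h2⟩
  · rcases ip_mem C.hv hz with h3 | ⟨-, h3⟩
    · rcases ip_mem C.hw hz with h4 | ⟨-, h4⟩
      · omega
      · exact Or.inr (Or.inr h4.symm)
    · exact Or.inr (Or.inl h3.symm)
  · exact Or.inl h2.symm

lemma Config₃.deg_d_ne_four {b E c y β v w r s j k p q ρ σ U W d e f : R}
    (C : T.Config₃ b E c y β v w r s j k p q ρ σ U W d e f) : T.deg d ≠ 4 := by
  intro dd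
  have nr := T.ip_self r C.hr
  have dE := C.dE
  have icv := ip_eq_zero_of_deg C.hc C.hv (by rw [C.dc, C.dv]; decide)
  have n1 := T.ip_self 1 T.one_mem
  have nE := T.ip_self E C.hE
  have E1 := ip_one_of_deg C.hE (by omega)
  have i1E := T.ip_symm 1 E
  obtain ⟨X, pX, eX, X1, dX, nX⟩ := C.norm_bar_mul C.hd
  have hX := pX.ip_mul_deg_le C.hE
  rw [dX, dd, dE] at hX
  obtain ⟨z, hz, ez, cz, dz, hz'⟩ := C.bar_b_mul_d (by omega)
  have h : z = v := by
    rcases hz' with rfl | rfl | rfl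
    · have := C.dβ; omega
    · rfl
    · have := C.dw; omega
  subst h
  have nbd : T.ip (T.bar b * d) (T.bar b * d) = 2 := by
    rw [ez, ip_add_self, T.ip_self c C.hc, T.ip_self z hz, cz]; rfl
  obtain ⟨ρ', pρ', rfl⟩ := pX.peel C.hE (by omega)
  rw [map_add] at dX
  rw [dE, dd] at dX
  rw [T.ip_add_left] at X1 nX
  have hle := C.pρ.ip_le_two_of_deg_seven C.ρ1 C.dρ pρ' (by omega)
  have bdr : T.ip (b * d) r = 0 := by
    have hs := C.bd_s
    obtain ⟨t, pt, et, -, nt⟩ := ((Pos.of_mem C.hb).mul (Pos.of_mem C.hd)).peel_norm C.hs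
      (by omega) (by rw [← ip_bar_mul_mul]; omega)
    rw [← ip_bar_mul_mul] at nt
    have ht := pt.mem_of_norm (by omega)
    have hdt := congrArg T.deg et
    rw [map_mul, map_add, C.db, C.ds, dd] at hdt
    rw [et, T.ip_add_left, ip_eq_zero_of_deg C.hs C.hr (by rw [C.ds, C.dr]; decide),
      ip_eq_zero_of_deg ht C.hr (by rw [C.dr]; omega)]
    rfl
  have hbc := congrArg T.bar C.bc
  rw [map_mul, map_add, T.bar_bar] at hbc
  have hy2 : T.ip (r * T.bar d) y = 2 := by
    have h1 : T.ip (b * T.bar c * r) d = 2 := by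
      rw [mul_assoc, ip_mul_left, ez, C.cr, ← ez, nbd]
    rw [hbc, add_mul, T.ip_add_left, ip_mul_left, T.bar_bar, T.ip_symm, bdr, zero_add] at h1
    rw [← h1]
    apply ip_congr
    ring
  have hrd := (Pos.of_mem C.hr).mul (Pos.of_mem (T.bar_mem d C.hd))
  have ny := T.ip_self y C.hy
  obtain ⟨t1, pt1, et1⟩ := hrd.peel C.hy (by omega)
  rw [et1, T.ip_add_left] at hy2
  obtain ⟨t, pt, rfl⟩ := pt1.peel C.hy (by omega)
  have dt := congrArg T.deg et1
  rw [mul_deg_bar C.hd, map_add, map_add, C.dr, dd, C.dy] at dt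
  have h1 := pt.ip_nonneg pt
  have h2 := (Pos.of_mem C.hy).ip_nonneg pt
  have h0 : T.ip t t ≠ 0 := fun h0 => by
    rw [pt.eq_zero_of_norm h0.le, map_zero] at dt
    omega
  have nn : T.ip (r * T.bar d) (r * T.bar d) = 2 + T.ip ρ ρ' := by
    rw [ip_mul_self, T.bar_bar, mul_comm (T.bar d), eX, C.rr]
    simp only [T.ip_add_left, ip_add_right]
    have := C.ρ1
    have := C.ρE
    have := T.ip_symm E ρ'
    have := T.ip_symm 1 ρ'
    omega
  rw [et1, ip_add_self, ip_add_self, ip_add_right] at nn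
  omega

/-- The case in which `d` has degree three. -/
structure Config₄ (T : IntTA R) (b E c y β v w r s j k p q ρ σ U W d e f ω η ι : R) : Prop
    extends T.Config₃ b E c y β v w r s j k p q ρ σ U W d e f where
  hω : ω ∈ T.B
  hη : η ∈ T.B
  hι : ι ∈ T.B
  dd : T.deg d = 3
  dω : T.deg ω = 6
  dη : T.deg η = 6
  dι : T.deg ι = 4
  ω_eq : ω = β ∨ ω = w
  dd' : d * T.bar d = 1 + E
  bd' : T.bar b * d = c + ω
  cd' : T.bar c * d = b + η
  bd : b * d = s + ι

lemma Config₄.swap_jk {b E c y β v w r s j k p q ρ σ U W d e f ω η ι : R}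
    (C : T.Config₄ b E c y β v w r s j k p q ρ σ U W d e f ω η ι) :
    T.Config₄ b E c y β v w r s k j p q ρ σ U W d e f ω η ι :=
  { C with toConfig₃ := C.toConfig₃.swap_jk }

lemma Config₃.exists_config₄ {b E c y β v w r s j k p q ρ σ U W d e f : R}
    (C : T.Config₃ b E c y β v w r s j k p q ρ σ U W d e f) :
    ∃ ω η ι, T.Config₄ b E c y β v w r s j k p q ρ σ U W d e f ω η ι := by
  have dd : T.deg d = 3 := by
    have h1 := three_le_deg C.hd C.d1
    have h2 := C.deg_d_ne_four
    have h3 := C.dde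
    have h4 := C.dle
    omega
  have dE := C.dE
  obtain ⟨X, pX, eX, X1, dX, nX⟩ := C.norm_bar_mul C.hd
  have hX := pX.ip_mul_deg_le C.hE
  rw [dX, dd, dE] at hX
  obtain ⟨ω, hω, eω, cω, dω, hω'⟩ := C.bar_b_mul_d (by omega)
  rw [dd] at dω
  have nbd : T.ip (T.bar b * d) (T.bar b * d) = 2 := by
    rw [eω, ip_add_self, T.ip_self c C.hc, T.ip_self ω hω, cω]; rfl
  obtain ⟨X', pX', rfl⟩ := pX.peel C.hE (by omega)
  rw [map_add, dd, dE] at dX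
  rw [pX'.eq_zero_of_deg (by omega), add_zero] at eX
  have hcdb := C.cd_b
  have hbds := C.bd_s
  obtain ⟨η, pη, eη, -, nη⟩ :=
    ((Pos.of_mem C.hc).bar.mul (Pos.of_mem C.hd)).peel_norm C.hb (by omega)
      (by rw [← C.norm_b_eq_c]; omega)
  rw [← C.norm_b_eq_c] at nη
  obtain ⟨ι, pι, eι, -, nι⟩ :=
    ((Pos.of_mem C.hb).mul (Pos.of_mem C.hd)).peel_norm C.hs (by omega)
      (by rw [← ip_bar_mul_mul]; omega)
  rw [← ip_bar_mul_mul] at nι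
  have dη := congrArg T.deg eη
  have dι := congrArg T.deg eι
  rw [bar_mul_deg C.hc, map_add, C.dc, dd, C.db] at dη
  rw [map_mul, map_add, C.db, dd, C.ds] at dι
  exact ⟨ω, η, ι, { C with
    hω := hω
    hη := pη.mem_of_norm (by omega)
    hι := pι.mem_of_norm (by omega)
    dd := dd
    dω := by omega
    dη := by omega
    dι := by omega
    ω_eq := by
      rcases hω' with h | h | h
      · exact Or.inl h
      · rw [h, C.dv] at dω
        omega
      · exact Or.inr h
    dd' := eX, bd' := eω, cd' := eη, bd := eι }⟩

lemma eq_of_ip_two {a₁ a₂ : R} (hx : x ∈ T.B) (h₁ : a₁ ∈ T.B) (h₂ : a₂ ∈ T.B)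
    (h : 1 ≤ T.ip (a₁ + a₂) x) : x = a₁ ∨ x = a₂ := by
  rw [T.ip_add_left] at h
  rcases ip_mem h₁ hx with h1 | h1
  · exact Or.inr (eq_of_ip h₂ hx (by omega)).symm
  · exact Or.inl h1.2.symm

lemma eq_of_ip_three {a₁ a₂ a₃ : R} (hx : x ∈ T.B) (h₁ : a₁ ∈ T.B) (h₂ : a₂ ∈ T.B)
    (h₃ : a₃ ∈ T.B) (h : 1 ≤ T.ip (a₁ + a₂ + a₃) x) : x = a₁ ∨ x = a₂ ∨ x = a₃ := by
  rw [add_assoc, T.ip_add_left] at h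
  rcases ip_mem h₁ hx with h1 | h1
  · exact Or.inr (eq_of_ip_two hx h₂ h₃ (by omega))
  · exact Or.inl h1.2.symm

lemma Pos.one_le_ip_add {s t : R} (ht : T.Pos t) (hx : x ∈ T.B) (hs : T.Pos s) :
    1 ≤ T.ip (t + (x + s)) x := by
  have h1 := ht.ip_nonneg (Pos.of_mem hx)
  have h2 := hs.ip_nonneg (Pos.of_mem hx)
  have h3 := T.ip_self x hx
  simp only [T.ip_add_left]
  omega

/-- A nonnegative summand of degree `8` of `p + q + bar p + bar q`, where `p` and `q` have
degrees adding up to `10`, is `q + bar q` or `p + bar p`. -/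
lemma summand_of_deg_eight {p q p' q' σ τ : R} (hp : p ∈ T.B) (hq : q ∈ T.B) (hp' : p' ∈ T.B)
    (hq' : q' ∈ T.B) (dp : 3 ≤ T.deg p) (dq : 3 ≤ T.deg q) (dpq : T.deg p + T.deg q = 10)
    (dp' : T.deg p' = T.deg p) (dq' : T.deg q' = T.deg q) (pσ : T.Pos σ) (dσ : T.deg σ = 8)
    (pτ : T.Pos τ) (h : τ + σ = p + q + p' + q') :
    T.deg q = 4 ∧ σ = q + q' ∨ T.deg p = 4 ∧ σ = p + p' := by
  have main : ∀ p q p' q' : R, p ∈ T.B → q ∈ T.B → p' ∈ T.B → q' ∈ T.B → 3 ≤ T.deg p →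
      3 ≤ T.deg q → T.deg p + T.deg q = 10 → T.deg p' = T.deg p → T.deg q' = T.deg q →
      τ + σ = p + q + p' + q' → 1 ≤ T.ip σ p → T.deg p = 4 ∧ σ = p + p' := by
    intro p q p' q' hp hq hp' hq' dp dq dpq dp' dq' h hσ
    obtain ⟨σ', pσ', e⟩ := pσ.peel hp hσ
    have d1 := congrArg T.deg e
    rw [map_add] at d1
    rcases pσ'.eq_zero_or_peel with rfl | ⟨x, hx, σ'', pσ'', e'⟩
    · rw [map_zero] at d1; omega
    · have h' : τ + (x + σ'') = q + p' + q' := by linear_combination h - e - e'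
      have h1 := pτ.one_le_ip_add hx pσ''
      rw [h'] at h1
      rw [e', map_add] at d1
      have d2 := pσ''.deg_nonneg
      rcases eq_of_ip_three hx hq hp' hq' h1 with rfl | rfl | rfl
      · omega
      · have d3 : σ'' = 0 := by
          rcases pσ''.eq_zero_or_peel with h0 | ⟨z, hz, σ₃, pσ₃, e₃⟩
          · exact h0
          · have h'' : τ + (z + σ₃) = q + q' := by linear_combination h' - e₃
            have h2 := pτ.one_le_ip_add hz pσ₃
            rw [h''] at h2
            have d4 := pσ₃.deg_nonneg
            rw [e₃, map_add] at d1
            rcases eq_of_ip_two hz hq hq' h2 with rfl | rfl <;> omega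
        rw [d3, map_zero] at d1
        refine ⟨by omega, ?_⟩
        rw [e, e', d3, add_zero]
      · omega
  rcases pσ.eq_zero_or_peel with rfl | ⟨x, hx, σ', pσ', e⟩
  · rw [map_zero] at dσ; omega
  · have h1 := pτ.one_le_ip_add hx pσ'
    have h2 : 1 ≤ T.ip σ x := by
      have := pσ'.ip_nonneg (Pos.of_mem hx)
      rw [e, T.ip_add_left, T.ip_self x hx]; omega
    rw [← e, h, add_assoc, T.ip_add_left] at h1
    by_cases h3 : 1 ≤ T.ip (p + q) x
    · rcases eq_of_ip_two hx hp hq h3 with rfl | rfl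
      · exact Or.inr (main x q p' q' hp hq hp' hq' dp dq dpq dp' dq' h h2)
      · exact Or.inl (main x p q' p' hq hp hq' hp' dq dp (by omega) dq' dp' (by rw [h]; ring) h2)
    · rcases eq_of_ip_two hx hp' hq' (by omega) with rfl | rfl
      · have := main x q p q' hp' hq hp hq' (by omega) dq (by omega) (by omega) dq'
          (by rw [h]; ring) h2
        exact Or.inr ⟨by omega, by rw [this.2]; ring⟩
      · have := main x p q p' hq' hp hq hp' (by omega) dp (by omega) (by omega) dp'
          (by rw [h]; ring) h2
        exact Or.inl ⟨by omega, by rw [this.2]; ring⟩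

lemma Config₂.deg_p {b E c y β v w r s j k p q ρ σ U W : R}
    (C : T.Config₂ b E c y β v w r s j k p q ρ σ U W) : 3 ≤ T.deg p := three_le_deg C.hp C.p1

lemma Config₂.deg_q {b E c y β v w r s j k p q ρ σ U W : R}
    (C : T.Config₂ b E c y β v w r s j k p q ρ σ U W) : 3 ≤ T.deg q := three_le_deg C.hq C.q1

lemma Config₂.E_sq {b E c y β v w r s j k p q ρ σ U W : R}
    (C : T.Config₂ b E c y β v w r s j k p q ρ σ U W) :
    E * E = 1 + 3 * E + p + q + ρ + U + W := by
  have h := congrArg T.bar C.cE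
  simp only [map_mul, map_add, C.barE] at h
  linear_combination c * h - E * C.cc + C.cc + C.cβ'_eq + C.cv' + C.cw'

lemma Config₂.bar_c_β {b E c y β v w r s j k p q ρ σ U W : R}
    (C : T.Config₂ b E c y β v w r s j k p q ρ σ U W) :
    T.bar c * β = E + T.bar p + T.bar q := by
  have h := congrArg T.bar C.cβ'_eq
  simpa only [map_mul, map_add, C.barE, T.bar_bar] using h

/-- If `U` has the constituent `x`, so has `c * bar v`. -/
lemma Config₂.one_le_cv' {b E c y β v w r s j k p q ρ σ U W : R}
    (C : T.Config₂ b E c y β v w r s j k p q ρ σ U W) (hx : x ∈ T.B) (h : 1 ≤ T.ip U x) :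
    1 ≤ T.ip (c * T.bar v) x := by
  have h1 := (Pos.of_mem C.hE).ip_nonneg (Pos.of_mem hx)
  have h2 := C.pρ.ip_nonneg (Pos.of_mem hx)
  rw [C.cv', T.ip_add_left, T.ip_add_left]
  omega

/-- A real basis element of degree three whose product with `c` contains a suitable element of
degree six forces a constituent of degree six in `E * E`. -/
lemma Config.exists_deg_six {b E c y β v w r s q x : R} (C : T.Config b E c y β v w r s)
    (hq : q ∈ T.B) (qbar : T.bar q = q) (dq : T.deg q = 3) (hx : x ∈ T.B) (dx : T.deg x = 6)
    (h1 : 1 ≤ T.ip (c * q) x) (h2 : 1 ≤ T.ip (c * E) x) :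
    ∃ m ∈ T.B, T.deg m = 6 ∧ 1 ≤ T.ip (E * E) m := by
  have dE := C.dE
  have dc := C.dc
  have pc := Pos.of_mem C.hc
  have norm : ∀ u ∈ T.B, T.deg u = 3 →
      T.ip (c * u) (c * u) ≤ 2 ∧ (T.ip (c * u) (c * u) = 2 → u * T.bar u = 1 + E) := by
    intro u hu du
    obtain ⟨X, pX, eX, X1, dX, nX⟩ := C.norm_bar_mul hu
    rw [C.norm_b_eq_c, ip_bar_mul_mul] at nX
    have hX := pX.ip_mul_deg_le C.hE
    rw [dX, du, dE] at hX
    refine ⟨by omega, fun h => ?_⟩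
    obtain ⟨X', pX', rfl⟩ := pX.peel C.hE (by omega)
    rw [map_add, du, dE] at dX
    rw [eX, pX'.eq_zero_of_deg (by omega), add_zero]
  obtain ⟨a, pa, ea, xa, na⟩ := (pc.mul (Pos.of_mem hq)).peel_norm hx h1
    (by have := (norm q hq dq).1; omega)
  have da := congrArg T.deg ea
  rw [map_mul, map_add, dc, dq, dx] at da
  have na0 : T.ip a a ≠ 0 := fun h0 => by
    rw [pa.eq_zero_of_norm h0.le, map_zero] at da
    omega
  have na1 := pa.ip_nonneg pa
  have nq := norm q hq dq
  have ha := pa.mem_of_norm (by omega)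
  have qq := nq.2 (by omega)
  rw [qbar] at qq
  have haq : T.ip (T.bar c * a) q = 1 := by
    rw [ip_mul_left, T.bar_bar, ea, T.ip_symm, T.ip_add_left, xa, T.ip_self a ha]; rfl
  have nca := (norm a ha (by omega)).1
  obtain ⟨m, pm, em, -, nm⟩ := (pc.bar.mul pa).peel_norm hq haq.ge
    (by rw [ip_bar_mul_mul]; omega)
  have dm := congrArg T.deg em
  rw [bar_mul_deg C.hc, map_add, dc, dq] at dm
  have nm0 : T.ip m m ≠ 0 := fun h0 => by
    rw [pm.eq_zero_of_norm h0.le, map_zero] at dm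
    omega
  have nm1 := pm.ip_nonneg pm
  rw [ip_bar_mul_mul] at nm
  have hm := pm.mem_of_norm (by omega)
  have Eq : E * q = T.bar c * x + m := by
    linear_combination T.bar c * ea + em - q * C.cc
  have iEm := ip_eq_zero_of_deg C.hE hm (by omega)
  have h3 : 1 ≤ T.ip (E * q) E := by
    have := pm.ip_nonneg (Pos.of_mem C.hE)
    rw [ip_mul] at h2
    rw [Eq, T.ip_add_left, ip_mul_left, T.bar_bar, T.ip_symm, ip_mul]
    omega
  have h4 : 1 ≤ T.ip (E * q) m := by
    have := (pc.bar.mul (Pos.of_mem hx)).ip_nonneg pm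
    rw [Eq, T.ip_add_left, T.ip_self m hm]
    omega
  refine ⟨m, hm, by omega, ?_⟩
  obtain ⟨t, pt, et⟩ := ((Pos.of_mem C.hE).mul (Pos.of_mem hq)).peel C.hE h3
  have h5 : T.ip E (q * m) = T.ip (E * q) m := by
    apply ip_congr
    rw [map_mul, qbar]; ring
  have h6 : T.ip (E * q) (q * m) = T.ip E m + T.ip (E * E) m := by
    rw [← T.ip_add_left]
    apply ip_congr
    rw [map_mul, qbar]
    linear_combination E * T.bar m * qq
  have h7 := pt.ip_nonneg ((Pos.of_mem hq).mul pm)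
  rw [et, T.ip_add_left, h5] at h6
  omega

lemma Config₄.ι_eq {b E c y β v w r s j k p q ρ σ U W d e f ω η ι : R}
    (C : T.Config₄ b E c y β v w r s j k p q ρ σ U W d e f ω η ι) : ι = r ∨ ι = j ∨ ι = k := by
  have h := C.hbde
  rw [C.bd] at h
  have h1 := congrArg (fun z => T.ip z ι) h
  have h2 := ((Pos.of_mem C.hb).mul (Pos.of_mem C.he)).ip_nonneg (Pos.of_mem C.hι)
  have h3 := ip_eq_zero_of_deg C.hs C.hι (by rw [C.ds, C.dι]; decide)
  have h4 := T.ip_self ι C.hι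
  apply eq_of_ip_three C.hι C.hr C.hj C.hk
  simp only [T.ip_add_left, ip_two_mul_left] at h1 ⊢
  omega

/-- Reduction to `Config₂.terminal` when `bar U + σ = p + q + bar p + bar q`. -/
lemma Config₂.terminal_of_eq {b E c y β v w r s j k p q ρ σ U W : R}
    (C : T.Config₂ b E c y β v w r s j k p q ρ σ U W) (hW : W = T.bar p + T.bar q) : False := by
  have main : ∀ p q, T.Config₂ b E c y β v w r s j k p q ρ σ U W → W = T.bar p + T.bar q →
      T.deg q = 4 → σ = q + T.bar q → False := by
    intro p q C hW dq hσ
    have dp := C.dpq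
    have hp' := T.bar_mem p C.hp
    have hU : U = T.bar p + p := by
      have h := C.rel
      rw [hσ, hW] at h
      have h' : T.bar U = p + T.bar p := by linear_combination h
      have h'' := congrArg T.bar h'
      rwa [T.bar_bar, map_add, T.bar_bar] at h''
    have h0 := ip_mem_nonneg C.hp hp'
    have h1 := ip_mem_nonneg hp' C.hp
    refine C.terminal hp' (T.bar_mem q C.hq) (by omega) dq
      (by rw [deg_bar T p (Pos.of_mem C.hp)]; omega)
      (by rw [deg_bar T q (Pos.of_mem C.hq)]; omega) hW hσ (C.one_le_cv' C.hp ?_)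
      (C.one_le_cv' hp' ?_)
    · rw [hU, T.ip_add_left, T.ip_self p C.hp]; omega
    · rw [hU, T.ip_add_left, T.ip_self _ hp']; omega
  rcases summand_of_deg_eight C.hp C.hq (T.bar_mem p C.hp) (T.bar_mem q C.hq) C.deg_p C.deg_q
    C.dpq (deg_bar T p (Pos.of_mem C.hp)) (deg_bar T q (Pos.of_mem C.hq)) C.pσ C.dσ C.pU.bar
    (by rw [C.rel, hW]; ring) with ⟨h1, h2⟩ | ⟨h1, h2⟩
  · exact main p q C hW h1 h2
  · exact main q p C.swap_pq (by rw [hW]; ring) h1 h2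

/-- The subcase in which `p` and `q` are real, `p` lies in `U` and `q` in `σ`. -/
lemma Config₂.false_of_real {b E c y β v w r s j k p q ρ σ U W : R}
    (C : T.Config₂ b E c y β v w r s j k p q ρ σ U W) (pbar : T.bar p = p) (qbar : T.bar q = q)
    (hU : 1 ≤ T.ip U p) (hσ : 1 ≤ T.ip σ q) : False := by
  have pc := Pos.of_mem C.hc
  have hp := C.hp
  have hq := C.hq
  have dc := C.dc
  have dβ := C.dβ
  have dv := C.dv
  have dw := C.dw
  have dE := C.dE
  have dq3 := C.deg_q
  have dpq := C.dpq
  have npp := T.ip_self p hp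
  have nqq := T.ip_self q hq
  have ipq := C.pq
  have iqp := T.ip_symm q p
  have iEp := C.Ep
  have iEq := C.Eq
  have pE := T.ip_symm p E
  have qE := T.ip_symm q E
  have hβv := ip_eq_zero_of_deg C.hβ C.hv (by omega)
  have hcv'p := C.one_le_cv' hp hU
  have hcpβ : 1 ≤ T.ip (c * p) β := by
    rw [← pbar, ip_mul_bar, C.cβ'_eq]; simp only [T.ip_add_left]; omega
  have hcpv : 1 ≤ T.ip (c * p) v := by
    rw [← pbar, ip_mul_bar]; omega
  have dp5 := (pc.mul (Pos.of_mem hp)).deg_two C.hβ C.hv hβv hcpβ hcpv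
  rw [map_mul] at dp5
  rw [dc, dβ, dv] at dp5
  obtain ⟨U', pU', hU'⟩ := C.pU.peel hp hU
  obtain ⟨σ', pσ', hσ'⟩ := C.pσ.peel hq hσ
  have hW : W = T.bar U' + σ' := by
    have h := C.rel
    rw [hU', hσ', map_add, pbar] at h
    linear_combination -h
  have dU' := congrArg T.deg hU'
  have dσ' := congrArg T.deg hσ'
  rw [map_add, C.dU] at dU'
  rw [map_add, C.dσ] at dσ'
  have barσ' : T.bar σ' = σ' := by
    have h := C.barσ
    rw [hσ', map_add, qbar] at h
    exact add_left_cancel h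
  have U1 := C.U1
  have σ1 := C.σ1
  rw [hU', T.ip_add_left, C.p1, zero_add] at U1
  rw [hσ', T.ip_add_left, C.q1, zero_add] at σ1
  have hU'1 : T.ip (T.bar U') 1 = 0 := by rw [ip_bar_left, bar_one, U1]
  have hdU' := deg_bar T U' pU'
  have cEβ : 1 ≤ T.ip (c * E) β := by
    rw [C.cE]
    simp only [T.ip_add_left]
    have := T.ip_self β C.hβ
    have := ip_eq_zero_of_deg C.hc C.hβ (by omega)
    have := ip_eq_zero_of_deg C.hv C.hβ (by omega)
    have := ip_mem_nonneg C.hw C.hβ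
    omega
  have cEw : 1 ≤ T.ip (c * E) w := by
    rw [C.cE]
    simp only [T.ip_add_left]
    have := T.ip_self w C.hw
    have := ip_eq_zero_of_deg C.hc C.hw (by omega)
    have := ip_eq_zero_of_deg C.hv C.hw (by omega)
    have := C.βw
    omega
  have Esq : ∀ m ∈ T.B, T.deg m = 6 → 1 ≤ T.ip (E * E) m →
      1 ≤ T.ip p m + T.ip q m + T.ip (p + U') m + T.ip (T.bar U') m + T.ip σ' m := by
    intro m hm dm h
    have h1 := C.pρ.ip_eq_zero_of_deg_seven C.ρ1 C.dρ hm (by omega)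
    have h2 := ip_eq_zero_of_deg C.hE hm (by omega)
    have h3 := ip_eq_zero_of_deg T.one_mem hm (by rw [map_one]; omega)
    rw [C.E_sq, hW, hU'] at h
    simp only [T.ip_add_left, ip_three_mul_left] at h ⊢
    omega
  have small : ∀ z, T.Pos z → T.deg z < 6 → ∀ m ∈ T.B, T.deg m = 6 → T.ip z m = 0 := by
    intro z pz dz m hm dm
    have h1 := pz.ip_mul_deg_le hm
    have h2 := pz.ip_nonneg (Pos.of_mem hm)
    rw [dm] at h1
    omega
  rcases (by omega : T.deg p = 7 ∨ T.deg p = 5 ∨ T.deg p = 6) with dp | dp | dp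
  · have hcqβ : 1 ≤ T.ip (c * q) β := by
      rw [← qbar, ip_mul_bar, C.cβ'_eq]; simp only [T.ip_add_left]; omega
    obtain ⟨m, hm, dm, h⟩ := C.exists_deg_six hq qbar (by omega) C.hβ dβ hcqβ cEβ
    have h := Esq m hm dm h
    rw [T.ip_add_left, small q (Pos.of_mem hq) (by omega) m hm dm,
      ip_eq_zero_of_deg hp hm (by omega), small _ pU' (by omega) m hm dm,
      small _ pU'.bar (by omega) m hm dm, small _ pσ' (by omega) m hm dm] at h
    omega
  · have hmem := pσ'.mem_of_deg σ1 (by omega) (by omega)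
    have hcw : 1 ≤ T.ip (c * σ') w := by
      rw [← barσ', ip_mul_bar, C.cw', hW]
      simp only [T.ip_add_left]
      have := T.ip_self σ' hmem
      have := pU'.bar.ip_nonneg pσ'
      have := ip_mem_nonneg C.hE hmem
      omega
    obtain ⟨m, hm, dm, h⟩ := C.exists_deg_six hmem barσ' (by omega) C.hw dw hcw cEw
    have h := Esq m hm dm h
    rw [T.ip_add_left, small q (Pos.of_mem hq) (by omega) m hm dm,
      ip_eq_zero_of_deg hp hm (by omega), pU'.ip_eq_zero_of_deg_seven U1 (by omega) hm (by omega),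
      pU'.bar.ip_eq_zero_of_deg_seven hU'1 (by omega) hm (by omega),
      small _ pσ' (by omega) m hm dm] at h
    omega
  · have hσmem := pσ'.mem_of_deg σ1 (by omega) (by omega)
    have hx : U' ∈ T.B := by
      rcases pU'.eq_zero_or_peel with rfl | ⟨x, hx, U₂, pU₂, rfl⟩
      · rw [map_zero] at dU'; omega
      have h1 := ip_mem_nonneg hx T.one_mem
      have h2 := pU₂.ip_nonneg (Pos.of_mem T.one_mem)
      rw [T.ip_add_left] at U1
      have h3 := three_le_deg hx (by omega)
      rw [map_add] at dU'
      rcases pU₂.eq_zero_or_three_le (by omega) with rfl | h4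
      · rwa [add_zero]
      exfalso
      have hx' := T.bar_mem x hx
      have dx : T.deg x = 3 := by omega
      have hUx : 1 ≤ T.ip U x := by
        have := ip_mem_nonneg hp hx
        have := pU₂.ip_nonneg (Pos.of_mem hx)
        have := T.ip_self x hx
        rw [hU']
        simp only [T.ip_add_left]
        omega
      have h5 := C.one_le_cv' hx hUx
      rw [ip_mul_bar] at h5
      obtain ⟨t, pt, et⟩ := (pc.mul (Pos.of_mem hx')).peel C.hv h5
      have dt := congrArg T.deg et
      rw [mul_deg_bar hx, map_add, dc, dv, dx] at dt
      rw [pt.eq_zero_of_deg (by omega), add_zero] at et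
      have h6 : T.ip (c * x) (c * x) = 1 := by
        rw [← ip_mul_bar_bar, et, T.ip_self v C.hv]
      have hcx := (pc.mul (Pos.of_mem hx)).mem_of_norm h6
      have h7 : 1 ≤ T.ip (c * x) w := by
        rw [← T.bar_bar x, ip_mul_bar, C.cw', hW, map_add]
        simp only [T.ip_add_left]
        have := ip_mem_nonneg C.hE hx'
        have := pU₂.bar.ip_nonneg (Pos.of_mem hx')
        have := ip_mem_nonneg hσmem hx'
        have := T.ip_self _ hx'
        omega
      have h8 := congrArg T.deg (eq_of_ip hcx C.hw h7)
      rw [map_mul] at h8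
      rw [dc, dx, dw] at h8
      omega
    have hx' := T.bar_mem U' hx
    have nx := T.ip_self U' hx
    have nx' := T.ip_self _ hx'
    by_cases hbar : T.bar U' = p ∨ T.bar U' = U'
    · refine C.terminal hx' hσmem dp (by omega) (by omega) (by omega) hW hσ' hcv'p
        (C.one_le_cv' hx' ?_)
      have h1 := ip_mem_nonneg hp hx'
      have h2 := ip_mem_nonneg hx hx'
      rw [hU', T.ip_add_left]
      rcases hbar with h | h
      · rw [h] at h1 h2 ⊢
        omega
      · rw [h] at h1 h2 ⊢
        omega
    · obtain ⟨hne, hne'⟩ := not_or.mp hbar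
      have ipx' := T.ip_ne p hp _ hx' (Ne.symm hne)
      have ipx : T.ip p U' = 0 := by
        rw [← ip_bar_bar, pbar, ipx']
      have ixx' := T.ip_ne _ hx _ hx' (Ne.symm hne')
      have hEp : T.ip (E * p) (T.bar U') = T.ip (E * p) U' := by
        rw [← ip_bar_bar, map_mul, C.barE, pbar, T.bar_bar]
      have hUx : 1 ≤ T.ip U U' := by
        rw [hU', T.ip_add_left]; omega
      have hcx'v := C.one_le_cv' hx hUx
      rw [ip_mul_bar] at hcx'v
      obtain ⟨n, pn, en⟩ := (pc.mul (Pos.of_mem hp)).peel_two C.hβ C.hv hβv hcpβ hcpv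
      have dn := congrArg T.deg en
      rw [map_mul, map_add, map_add, dc, dp, dβ, dv] at dn
      have hcx := pc.mul (Pos.of_mem hx)
      have hcx' := pc.mul (Pos.of_mem hx')
      have h1 : 1 ≤ T.ip (c * p) (c * U') := by
        have h2 : 1 ≤ T.ip (c * p) (c * T.bar U') := by
          have h3 := (Pos.of_mem C.hβ).ip_nonneg hcx'
          have h4 := pn.ip_nonneg hcx'
          rw [T.ip_symm] at hcx'v
          rw [en]
          simp only [T.ip_add_left]
          omega
        rw [ip_mul_mul C.cc] at h2 ⊢
        omega
      have hβ0 : T.ip β (c * U') = 0 := by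
        rw [T.ip_symm, ← T.bar_bar U', ip_mul_bar, C.cβ'_eq]
        simp only [T.ip_add_left]
        have := ip_eq_zero_of_deg C.hE hx' (by omega)
        have := ip_eq_zero_of_deg hq hx' (by omega)
        omega
      have hv0 : T.ip v (c * U') = 0 := by
        rw [T.ip_symm, ← T.bar_bar U', ip_mul_bar, C.cv', hU']
        simp only [T.ip_add_left]
        have := ip_eq_zero_of_deg C.hE hx' (by omega)
        have := C.pρ.ip_eq_zero_of_deg_seven C.ρ1 C.dρ hx' (by omega)
        omega
      rw [en] at h1
      simp only [T.ip_add_left] at h1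
      have h2 : T.ip (c * p) 1 = 0 := by
        rw [ip_mul_left, mul_one, ip_eq_zero_of_deg hp (T.bar_mem c C.hc)
          (by rw [deg_bar T c pc]; omega)]
      rw [en] at h2
      simp only [T.ip_add_left] at h2
      have hn := pn.mem_of_deg (by
        have := ip_mem_nonneg C.hβ T.one_mem
        have := ip_mem_nonneg C.hv T.one_mem
        have := pn.ip_nonneg (Pos.of_mem T.one_mem)
        omega) (by omega) (by omega)
      have h3 : 1 ≤ T.ip (T.bar c * n) U' := by rw [← ip_mul, T.ip_symm]; omega
      have h4 : 1 ≤ T.ip (T.bar c * n) p := by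
        rw [← ip_mul, en]
        simp only [T.ip_add_left]
        have := T.ip_self n hn
        have := ip_mem_nonneg C.hβ hn
        have := ip_mem_nonneg C.hv hn
        omega
      have h5 := (pc.bar.mul pn).deg_two hp hx ipx h4 h3
      rw [bar_mul_deg C.hc] at h5
      rw [dc, dp] at h5
      omega

/-- The subcase in which `p + q` is real. -/
lemma Config₂.false_of_add_real {b E c y β v w r s j k p q ρ σ U W : R}
    (C : T.Config₂ b E c y β v w r s j k p q ρ σ U W) (h : T.bar p + T.bar q = p + q) :
    False := by
  have pc := Pos.of_mem C.hc
  have both : ∀ p q, T.Config₂ b E c y β v w r s j k p q ρ σ U W →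
      1 ≤ T.ip σ p + T.ip (T.bar U) p := by
    intro p q C
    have h1 := C.pW.ip_nonneg (Pos.of_mem C.hp)
    have h2 := ip_mem_nonneg C.hq C.hp
    rw [add_comm, ← T.ip_add_left, C.rel]
    simp only [T.ip_add_left]
    rw [T.ip_self p C.hp]
    omega
  have hp := both p q C
  have hq := both q p C.swap_pq
  have hpU := C.pU.bar.ip_nonneg (Pos.of_mem C.hp)
  have hqU := C.pU.bar.ip_nonneg (Pos.of_mem C.hq)
  have not_both : 1 ≤ T.ip σ p → ¬ 1 ≤ T.ip σ q := by
    intro h1 h2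
    have h3 := C.pσ.deg_two C.hp C.hq C.pq h1 h2
    rw [C.dpq, C.dσ] at h3
    omega
  have not_both' : 5 ≤ T.deg p → 5 ≤ T.deg q → 1 ≤ T.ip (T.bar U) p →
      ¬ 1 ≤ T.ip (T.bar U) q := by
    intro h1 h2 h3 h4
    obtain ⟨t, pt, ht⟩ := C.pU.bar.peel_two C.hp C.hq C.pq h3 h4
    have h5 := congrArg T.deg ht
    have h6 := congrArg (T.ip · 1) ht
    have hU1 : T.ip (T.bar U) 1 = 0 := by rw [ip_bar_left, bar_one, C.U1]
    simp only [map_add, T.ip_add_left, C.p1, C.q1, hU1] at h5 h6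
    rw [deg_bar T U C.pU, C.dU] at h5
    have := C.dpq
    rcases pt.eq_zero_or_three_le (by omega) with rfl | h7
    · rw [map_zero] at h5; omega
    · omega
  have hσ : T.ip σ (T.bar p) = T.ip σ p := by rw [← ip_bar_left, C.barσ]
  have h1 : 1 ≤ T.ip (p + q) (T.bar p) := by
    have := T.ip_self _ (T.bar_mem p C.hp)
    have := ip_mem_nonneg (T.bar_mem q C.hq) (T.bar_mem p C.hp)
    rw [← h, T.ip_add_left]
    omega
  rcases eq_of_ip_two (T.bar_mem p C.hp) C.hp C.hq h1 with pbar | rfl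
  · have qbar : T.bar q = q := by
      rw [pbar] at h
      exact add_left_cancel h
    have main : ∀ p q, T.Config₂ b E c y β v w r s j k p q ρ σ U W → T.bar p = p →
        1 ≤ T.ip (T.bar U) p → 5 ≤ T.deg p := by
      intro p q C pbar h1
      have hβv := ip_eq_zero_of_deg C.hβ C.hv (by rw [C.dβ, C.dv]; decide)
      have h2 : 1 ≤ T.ip (c * p) β := by
        rw [← pbar, ip_mul_bar, C.cβ'_eq]
        simp only [T.ip_add_left]
        have := T.ip_self p C.hp
        have := ip_mem_nonneg C.hE C.hp
        have := ip_mem_nonneg C.hq C.hp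
        omega
      have h3 : 1 ≤ T.ip (c * p) v := by
        rw [← pbar, ip_mul_bar]
        exact C.one_le_cv' C.hp (by rwa [ip_bar_left, pbar] at h1)
      have h4 := (pc.mul (Pos.of_mem C.hp)).deg_two C.hβ C.hv hβv h2 h3
      rw [map_mul] at h4
      rw [C.dc, C.dβ, C.dv] at h4
      omega
    have hp5 := main p q C pbar
    have hq5 := main q p C.swap_pq qbar
    by_cases h2 : 1 ≤ T.ip (T.bar U) p
    · have h3 : ¬ 1 ≤ T.ip (T.bar U) q := fun h3 => not_both' (hp5 h2) (hq5 h3) h2 h3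
      rw [ip_bar_left, pbar] at h2
      exact C.false_of_real pbar qbar h2 (by omega)
    · have h3 : 1 ≤ T.ip (T.bar U) q := by
        have := not_both (by omega)
        omega
      rw [ip_bar_left, qbar] at h3
      exact C.swap_pq.false_of_real qbar pbar h3 (by omega)
  · have dpq := C.dpq
    have dp := deg_bar T p (Pos.of_mem C.hp)
    by_cases h2 : 1 ≤ T.ip σ p
    · exact not_both h2 (by rw [hσ]; exact h2)
    · exact not_both' (by omega) (by omega) (by omega) (by omega)

lemma Config₄.bar_c_ω {b E c y β v w r s j k p q ρ σ U W d e f ω η ι : R}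
    (C : T.Config₄ b E c y β v w r s j k p q ρ σ U W d e f ω η ι) :
    T.bar c * ω = T.bar b * η := by
  linear_combination T.bar b * C.cd' - T.bar c * C.bd' + C.bb - C.cc

lemma Config₄.ip_η_y {b E c y β v w r s j k p q ρ σ U W d e f ω η ι : R}
    (C : T.Config₄ b E c y β v w r s j k p q ρ σ U W d e f ω η ι) :
    T.ip η y = T.ip ι r := by
  have h : T.ip (T.bar c * d) (T.bar b * c) = T.ip (b * d) (c * c) :=
    ip_congr (by simp only [map_mul, T.bar_bar]; ring)
  have h1 := ip_eq_zero_of_deg C.hb C.hy (by rw [C.db, C.dy]; decide)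
  have h2 := ip_eq_zero_of_deg C.hη C.hb (by rw [C.db, C.dη]; decide)
  have h3 := ip_eq_zero_of_deg C.hs C.hr (by rw [C.ds, C.dr]; decide)
  have h4 := ip_eq_zero_of_deg C.hι C.hs (by rw [C.ds, C.dι]; decide)
  rw [C.cd', C.bc, C.bd, C.csq] at h
  simp only [T.ip_add_left, ip_add_right] at h
  rw [T.ip_self b C.hb, T.ip_self s C.hs] at h
  omega

lemma Config₄.ι_ne_r {b E c y β v w r s j k p q ρ σ U W d e f ω η ι : R}
    (C : T.Config₄ b E c y β v w r s j k p q ρ σ U W d e f ω η ι) : ι ≠ r := by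
  rintro rfl
  have h := C.ip_η_y
  rw [T.ip_self ι C.hι] at h
  obtain rfl := eq_of_ip C.hη C.hy h.ge
  have h1 := C.bar_c_ω
  rw [← C.cβ', C.cβ'_eq] at h1
  rcases C.ω_eq with rfl | rfl
  · rw [C.bar_c_β] at h1
    exact C.toConfig₂.false_of_add_real (by linear_combination h1)
  · have h2 := congrArg T.bar C.cw'
    simp only [map_mul, map_add, C.barE, T.bar_bar] at h2
    have h3 : T.bar W = p + q := by linear_combination h1 - h2
    have h4 := congrArg T.bar h3
    rw [T.bar_bar, map_add] at h4
    exact C.toConfig₂.terminal_of_eq h4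

lemma Pos.exists_eq_add (h : T.Pos a) (hx : x ∈ T.B) (h1 : 1 ≤ T.ip a x) (h2 : T.ip a a ≤ 2)
    (hd : T.deg x < T.deg a) : ∃ t ∈ T.B, a = x + t := by
  obtain ⟨t, pt, e, -, nt⟩ := h.peel_norm hx h1 (by omega)
  refine ⟨t, pt.mem_of_norm ?_, e⟩
  have h3 := pt.ip_nonneg pt
  by_contra h4
  rw [e, pt.eq_zero_of_norm (by omega), add_zero] at hd
  exact lt_irrefl _ hd

lemma Config.norm_le_two {b E c y β v w r s : R} (C : T.Config b E c y β v w r s)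
    (hu : u ∈ T.B) (du : T.deg u = 4) : T.ip (T.bar b * u) (T.bar b * u) ≤ 2 := by
  obtain ⟨X, pX, eX, X1, dX, nX⟩ := C.norm_bar_mul hu
  have hX := pX.ip_mul_deg_le C.hE
  rw [dX, du, C.dE] at hX
  omega

/-- If `b * d = s + j`, the constituent `ω` of `bar b * d` is `β`. -/
lemma Config₄.ω_eq_β {b E c y β v w r s j k p q ρ σ U W d e f ω η : R}
    (C : T.Config₄ b E c y β v w r s j k p q ρ σ U W d e f ω η j) : ω = β := by
  refine C.ω_eq.resolve_right ?_
  rintro rfl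
  have pb := Pos.of_mem C.hb
  have nj := T.ip_self j C.hj
  have hcω : c * ω + r = y * d + j := by
    linear_combination (-c) * C.bd' + d * C.bc + C.bd - C.csq
  have hcω_j := congrArg (T.ip · j) hcω
  have hyd := ((Pos.of_mem C.hy).mul (Pos.of_mem C.hd)).ip_nonneg (Pos.of_mem C.hj)
  simp only [T.ip_add_left, C.rj] at hcω_j
  obtain ⟨t, ht, et⟩ := (pb.bar.mul (Pos.of_mem C.hj)).exists_eq_add C.hd
    (by rw [← ip_mul, C.bd, T.ip_add_left, C.sj, nj]; rfl) (C.norm_le_two C.hj C.dι)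
    (by rw [bar_mul_deg C.hb, C.db, C.dι, C.dd]; decide)
  have dt := congrArg T.deg et
  rw [bar_mul_deg C.hb, map_add, C.db, C.dι, C.dd] at dt
  have hbf : T.ip (b * f) j = 0 := by
    rw [ip_mul, et, T.ip_add_left, ip_eq_zero_of_deg C.hd C.hf (by rw [C.dd, C.df]; decide),
      ip_eq_zero_of_deg ht C.hf (by rw [C.df]; omega)]
    rfl
  have h : r + s + (s + j + k) + c * ω = r + 2 * s + j + k + b * f := by
    linear_combination (-c) * C.cs + s * C.cc - s * C.bb + b * C.bs - C.csq - C.cβ + C.hbde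
  have h' := congrArg (T.ip · j) h
  simp only [T.ip_add_left, ip_two_mul_left, hbf] at h'
  omega

lemma Config₄.b_E {b E c y β v w r s j k p q ρ σ U W d e f ω η : R}
    (C : T.Config₄ b E c y β v w r s j k p q ρ σ U W d e f ω η j) :
    ∃ θ ∈ T.B, T.deg θ = 9 ∧ b * E = b + y + η + θ := by
  have pb := Pos.of_mem C.hb
  have pc := Pos.of_mem C.hc
  have nb := T.ip_self b C.hb
  have ny := T.ip_self y C.hy
  have nη := T.ip_self η C.hη
  have iby := ip_eq_zero_of_deg C.hb C.hy (by rw [C.db, C.dy]; decide)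
  have ibη := ip_eq_zero_of_deg C.hb C.hη (by rw [C.db, C.dη]; decide)
  have iyη : T.ip y η = 0 := by rw [T.ip_symm, C.ip_η_y, T.ip_symm, C.rj]
  have h1 : b * E = y + c * T.bar y := by
    have h := congrArg T.bar C.bc
    simp only [map_mul, map_add, T.bar_bar] at h
    linear_combination c * h - b * C.cc + C.bc
  have h2 : b * E = η + T.bar c * e := by
    linear_combination C.cd' - C.hcde
  have hb : 1 ≤ T.ip (b * E) b := by
    have := T.ip_self E C.hE
    have := ip_mem_nonneg T.one_mem C.hE
    rw [ip_mul, mul_comm, C.bb, T.ip_add_left]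
    omega
  have hy : 1 ≤ T.ip (b * E) y := by
    have := (pc.mul (Pos.of_mem C.hy).bar).ip_nonneg (Pos.of_mem C.hy)
    rw [h1, T.ip_add_left]
    omega
  have hη : 1 ≤ T.ip (b * E) η := by
    have := (pc.bar.mul (Pos.of_mem C.he)).ip_nonneg (Pos.of_mem C.hη)
    rw [h2, T.ip_add_left]
    omega
  obtain ⟨θ, pθ, eθ⟩ := (pb.mul (Pos.of_mem C.hE)).peel_three C.hb C.hy C.hη iby ibη iyη hb hy hη
  have dθ := congrArg T.deg eθ
  rw [map_mul, map_add, map_add, map_add, C.db, C.dE, C.dy, C.dη] at dθ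
  refine ⟨θ, pθ.mem_of_norm ?_, by omega, eθ⟩
  have n := C.normE
  have n1 := pb.ip_nonneg pθ
  have n2 := (Pos.of_mem C.hy).ip_nonneg pθ
  have n3 := (Pos.of_mem C.hη).ip_nonneg pθ
  have n4 := pθ.ip_nonneg pθ
  rw [eθ] at n
  simp only [T.ip_add_left, ip_add_right] at n
  rw [T.ip_symm y b, T.ip_symm η b, T.ip_symm η y, T.ip_symm θ b, T.ip_symm θ y,
    T.ip_symm θ η] at n
  by_contra h3
  rw [pθ.eq_zero_of_norm (by omega), map_zero] at dθ
  omega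

/-- The subcase in which `σ` and the square of `E` are expressed through `p` and `q`. -/
lemma Config₂.false_of_σ_eq {b E c y β v w r s j k p q ρ σ U W J θ : R}
    (C : T.Config₂ b E c y β v w r s j k p q ρ σ U W) (dp : T.deg p = 6) (dq : T.deg q = 4)
    (hσ : σ = q + T.bar q) (hJ : ρ + U + W = p + 2 * T.bar p + T.bar q + J) (pJ : T.Pos J)
    (hθ : θ ∈ T.B) (dθ : T.deg θ = 9) (hby : 1 ≤ T.ip (b * p) y)
    (hbθ : 1 ≤ T.ip (b * p) θ) : False := by
  have hp := C.hp
  have hp' := T.bar_mem p hp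
  have hq' := T.bar_mem q C.hq
  have dp' := deg_bar T p (Pos.of_mem hp)
  have dq' := deg_bar T q (Pos.of_mem C.hq)
  have np := T.ip_self p hp
  have h1 : T.bar U + T.bar q = p + W := by linear_combination C.rel - hσ
  have hW : 1 ≤ T.ip W (T.bar q) := by
    have h2 := congrArg (T.ip · (T.bar q)) h1
    simp only [T.ip_add_left, T.ip_self _ hq', ip_eq_zero_of_deg hp hq' (by omega)] at h2
    have := C.pU.bar.ip_nonneg (Pos.of_mem hq')
    omega
  obtain ⟨W', pW', eW⟩ := C.pW.peel hq' hW
  have dW' := congrArg T.deg eW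
  rw [map_add, C.dW, dq', dq] at dW'
  have eU' : T.bar U = p + W' := by linear_combination h1 + eW
  have eU := congrArg T.bar eU'
  rw [T.bar_bar, map_add] at eU
  have h3 : ρ + (W' + T.bar W') = p + T.bar p + J := by linear_combination hJ - eU - eW
  have h4 := congrArg (T.ip · p) h3
  simp only [T.ip_add_left, np] at h4
  rw [C.pρ.ip_eq_zero_of_deg_seven C.ρ1 C.dρ hp (by omega), ip_bar_left] at h4
  have h5 := pJ.ip_nonneg (Pos.of_mem hp)
  have h6 := ip_mem_nonneg hp' hp
  have eq_of : ∀ x ∈ T.B, T.deg x = 6 → 1 ≤ T.ip W' x → W' = x := by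
    intro x hx dx h
    obtain ⟨t, pt, et⟩ := pW'.peel hx h
    have dt := congrArg T.deg et
    rw [map_add] at dt
    rw [et, pt.eq_zero_of_deg (by omega), add_zero]
  by_cases h7 : 1 ≤ T.ip W' (T.bar p)
  · refine C.terminal_of_eq ?_
    rw [eW, eq_of _ hp' (by omega) h7, add_comm]
  · rw [eq_of p hp dp (by omega)] at eU
    have hcp : 2 ≤ T.ip (c * p) v := by
      have := (Pos.of_mem C.hE).ip_nonneg (Pos.of_mem hp')
      have := C.pρ.ip_nonneg (Pos.of_mem hp')
      rw [← T.bar_bar p, ip_mul_bar, C.cv', eU]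
      simp only [T.ip_add_left]
      rw [T.ip_self _ hp']
      omega
    obtain ⟨t, pt, et⟩ := ((Pos.of_mem C.hc).mul (Pos.of_mem hp)).peel C.hv (by omega)
    rw [et, T.ip_add_left, T.ip_self v C.hv] at hcp
    obtain ⟨t', pt', rfl⟩ := pt.peel C.hv (by omega)
    have dt := congrArg T.deg et
    rw [map_mul, map_add, map_add, C.dc, dp, C.dv] at dt
    rw [pt'.eq_zero_of_deg (by omega), add_zero] at et
    have n := C.norm_b_eq_c p
    have nv := T.ip_self v C.hv
    obtain ⟨z, pz, ez⟩ := ((Pos.of_mem C.hb).mul (Pos.of_mem hp)).peel_two C.hy hθ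
      (ip_eq_zero_of_deg C.hy hθ (by rw [C.dy]; omega)) hby hbθ
    have dz := congrArg T.deg ez
    rw [map_mul, map_add, map_add, C.db, dp, C.dy, dθ] at dz
    have hz : z ∈ T.B := by
      refine pz.mem_of_deg ?_ (by omega) (by omega)
      have h8 : T.ip (b * p) 1 = 0 := by
        rw [ip_mul_left, mul_one, ip_eq_zero_of_deg hp (T.bar_mem b C.hb)
          (by rw [deg_bar T b (Pos.of_mem C.hb), C.db]; omega)]
      rw [ez, T.ip_add_left, T.ip_add_left] at h8
      have := ip_mem_nonneg C.hy T.one_mem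
      have := ip_mem_nonneg hθ T.one_mem
      have := pz.ip_nonneg (Pos.of_mem T.one_mem)
      omega
    rw [ip_bar_mul_mul, ip_bar_mul_mul, et, ez, add_assoc, ip_add_self y, ip_add_self θ,
      ip_add_right, ip_add_self v, T.ip_self y C.hy, T.ip_self θ hθ, T.ip_self z hz, nv,
      ip_eq_zero_of_deg C.hy hθ (by rw [C.dy]; omega),
      ip_eq_zero_of_deg C.hy hz (by rw [C.dy]; omega),
      ip_eq_zero_of_deg hθ hz (by omega)] at n
    omega

lemma Config₄.false_of_eq_j {b E c y β v w r s j k p q ρ σ U W d e f ω η : R}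
    (C : T.Config₄ b E c y β v w r s j k p q ρ σ U W d e f ω η j) : False := by
  obtain rfl := C.ω_eq_β
  obtain ⟨θ, hθ, dθ, bE⟩ := C.b_E
  have pb := Pos.of_mem C.hb
  have pd := Pos.of_mem C.hd
  have pj := Pos.of_mem C.hj
  have nj := T.ip_self j C.hj
  obtain ⟨t, ht, et⟩ := (pd.bar.mul pj).exists_eq_add C.hb
    (by rw [← ip_mul, mul_comm, C.bd, T.ip_add_left, C.sj, nj]; rfl)
    (by
      have h := C.norm_le_two C.hj C.dι
      rw [ip_bar_mul_mul, ip_mul_mul C.bb] at h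
      rwa [ip_bar_mul_mul, ip_mul_mul C.dd'])
    (by rw [bar_mul_deg C.hd, C.db, C.dι, C.dd]; decide)
  have dt := congrArg T.deg et
  rw [bar_mul_deg C.hd, map_add, C.dd, C.dι, C.db] at dt
  have hds : T.bar d * s + (b + t) = 2 * b + y + η + θ := by
    linear_combination bE - et - T.bar d * C.bd + b * C.dd'
  obtain rfl : θ = t := by
    apply eq_of_ip hθ ht
    have h := congrArg (T.ip · t) hds
    have h1 := (pd.bar.mul (Pos.of_mem C.hs)).ip_nonneg (Pos.of_mem ht)
    have h2 := T.ip_self t ht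
    have h3 := ip_eq_zero_of_deg C.hb ht (by rw [C.db]; omega)
    have h4 := ip_eq_zero_of_deg C.hy ht (by rw [C.dy]; omega)
    have h5 := ip_eq_zero_of_deg C.hη ht (by rw [C.dη]; omega)
    simp only [T.ip_add_left, ip_two_mul_left] at h
    omega
  have hds' : T.bar d * s = b + y + η := by linear_combination hds
  have bds := congrArg T.bar hds'
  have bdj := congrArg T.bar et
  have by' := congrArg T.bar (C.cβ'.symm.trans C.cβ'_eq)
  have bη := congrArg T.bar (C.bar_c_ω.symm.trans C.bar_c_β)
  have bE' := congrArg T.bar bE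
  simp only [map_mul, map_add, T.bar_bar, C.barE] at bds bdj by' bη bE'
  have hss : T.bar s * j + σ = E + p + q + T.bar p + T.bar q := by
    linear_combination b * bds + C.bb + by' + bη - C.ss - T.bar s * C.bd
  have hsE : 1 ≤ T.ip (T.bar s * j) E := by
    have h := congrArg (T.ip · E) hss
    simp only [T.ip_add_left, C.σE, T.ip_self E C.hE] at h
    have := ip_mem_nonneg C.hp C.hE
    have := ip_mem_nonneg C.hq C.hE
    have := ip_mem_nonneg (T.bar_mem p C.hp) C.hE
    have := ip_mem_nonneg (T.bar_mem q C.hq) C.hE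
    omega
  obtain ⟨τ, pτ, eτ⟩ := ((Pos.of_mem C.hs).bar.mul pj).peel C.hE hsE
  obtain ⟨X, pX, eX, X1, dX, nX⟩ := C.norm_bar_mul C.hj
  have nbj : T.ip (T.bar b * j) (T.bar b * j) = T.ip (T.bar d * j) (T.bar d * j) := by
    rw [ip_bar_mul_mul, ip_bar_mul_mul, ip_mul_mul C.bb, ip_mul_mul C.dd']
  rw [nbj, et, ip_add_self, T.ip_self b C.hb, T.ip_self θ ht,
    ip_eq_zero_of_deg C.hb ht (by rw [C.db]; omega)] at nX
  obtain ⟨J, pJ, rfl⟩ := pX.peel C.hE (by omega)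
  rw [C.dι, map_add, C.dE] at dX
  have hbd := C.bd
  have key : ∀ p q, T.Config₂ b E c y ω v w r s j k p q ρ σ U W → T.deg q = 4 →
      σ = q + T.bar q → b * T.bar y = E + T.bar p + T.bar q →
      b * T.bar η = E + p + q → False := by
    intro p q C dq hσ by' bη
    have hp' := T.bar_mem p C.hp
    have hsj : T.bar s * j = E + p + T.bar p := by
      linear_combination b * bds + C.bb + by' + bη - C.ss - T.bar s * hbd - hσ
    have hjs := congrArg T.bar hsj
    simp only [map_mul, map_add, T.bar_bar, C.barE] at hjs
    have bθ : b * T.bar θ = E + J + p + T.bar p := by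
      linear_combination hjs + eX - b * bdj + T.bar j * hbd - C.bb
    have h1 := ip_mem_nonneg C.hE hp'
    have h2 := ip_mem_nonneg C.hp hp'
    have h3 := T.ip_self _ hp'
    refine C.false_of_σ_eq (by have := C.dpq; omega) dq hσ ?_ pJ ht dθ ?_ ?_
    · linear_combination b * bE' - C.E_sq - E * C.bb + C.bb + by' + bη + bθ
    · have := ip_mem_nonneg (T.bar_mem q C.hq) hp'
      rw [← T.bar_bar p, ip_mul_bar, by']
      simp only [T.ip_add_left]
      omega
    · have := pJ.ip_nonneg (Pos.of_mem hp')
      rw [← T.bar_bar p, ip_mul_bar, bθ]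
      simp only [T.ip_add_left]
      omega
  rcases summand_of_deg_eight C.hp C.hq (T.bar_mem p C.hp) (T.bar_mem q C.hq) C.deg_p C.deg_q
    C.dpq (deg_bar T p (Pos.of_mem C.hp)) (deg_bar T q (Pos.of_mem C.hq)) C.pσ C.dσ pτ
    (by linear_combination hss - eτ) with ⟨h1, h2⟩ | ⟨h1, h2⟩
  · exact key p q C.toConfig₂ h1 h2 by' bη
  · exact key q p C.toConfig₂.swap_pq h1 h2 (by rw [by']; ring) (by rw [bη]; ring)

lemma false_of_csq {b E c β r s : R} (hb : b ∈ T.B) (db : T.deg b = 3) (hE : E ∈ T.B)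
    (dE : T.deg E = 8) (bb : b * T.bar b = 1 + E) (hc : c ∈ T.B) (dc : T.deg c = 3)
    (cb' : c ≠ T.bar b) (hβ : β ∈ T.B) (dβ : T.deg β = 6) (sq : b * b = c + β)
    (normE : T.ip (b * E) (b * E) = 4) (hr : r ∈ T.B) (dr : T.deg r = 4) (hs : s ∈ T.B)
    (ds : T.deg s = 5) (csq : c * c = r + s) : False := by
  obtain ⟨y, v, w, C⟩ :=
    exists_config hb db hE dE bb hc dc cb' hβ dβ sq normE hr dr hs ds csq
  obtain ⟨j, k, p, q, ρ, σ, U, W, C⟩ := C.exists_config₂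
  obtain ⟨d, e, f, C⟩ := C.exists_config₃
  obtain ⟨ω, η, ι, C⟩ := C.exists_config₄
  rcases C.ι_eq with h | rfl | rfl
  · exact C.ι_ne_r h
  · exact C.false_of_eq_j
  · exact C.swap_jk.false_of_eq_j

end IntTA

namespace TAData

variable {A : Type} [CommRing A] [Algebra ℂ A]

lemma ip_eq_ite (T : TAData A) [DecidableEq A] {b c : A} (hb : b ∈ T.B) (hc : c ∈ T.B) :
    T.ip b c = if b = c then 1 else 0 := by
  split_ifs with h
  · rw [h, T.ip_self c hc]
  · exact T.ip_ne b hb c hc h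

lemma eq_sum_ip (T : TAData A) (a : A) : a = ∑ d ∈ T.B, T.ip a d • d := by
  classical
  have ha : a ∈ Submodule.span ℂ (T.B : Set A) := T.span_top ▸ Submodule.mem_top
  induction ha using Submodule.span_induction with
  | mem x hx =>
    rw [Finset.sum_congr rfl fun d hd => by rw [T.ip_eq_ite hx hd, ite_smul, one_smul, zero_smul],
      Finset.sum_ite_eq, if_pos (Finset.mem_coe.mp hx)]
  | zero => simp
  | add x y _ _ hx hy =>
    simp only [map_add, LinearMap.add_apply, add_smul, Finset.sum_add_distrib]
    rw [← hx, ← hy]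
  | smul r x _ hx =>
    simp only [map_smul, LinearMap.smul_apply, smul_assoc, ← Finset.smul_sum]
    rw [← hx]

lemma mul_mem_closure (T : TAData A) (hInt : T.Integral) {b c : A} (hb : b ∈ T.B)
    (hc : c ∈ T.B) : b * c ∈ AddSubmonoid.closure (T.B : Set A) := by
  rw [T.eq_sum_ip (b * c)]
  refine AddSubmonoid.sum_mem _ fun d hd => ?_
  obtain ⟨n, hn⟩ := hInt.1 b hb c hc d hd
  rw [hn, Nat.cast_smul_eq_nsmul]
  exact AddSubmonoid.nsmul_mem _ (AddSubmonoid.subset_closure hd) n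

/-- The integral combinations of basis elements. -/
def integralSubring (T : TAData A) : Subring A := Subring.closure (T.B : Set A)

lemma basis_mem (T : TAData A) {b : A} (hb : b ∈ T.B) : b ∈ T.integralSubring :=
  Subring.subset_closure hb

lemma mem_addSubgroup_closure (T : TAData A) (hInt : T.Integral) {a : A}
    (ha : a ∈ T.integralSubring) : a ∈ AddSubgroup.closure (T.B : Set A) := by
  induction ha using Subring.closure_induction with
  | mem x hx => exact AddSubgroup.subset_closure hx
  | zero => exact zero_mem _
  | one => exact AddSubgroup.subset_closure T.one_mem
  | add x y _ _ hx hy => exact add_mem hx hy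
  | neg x _ hx => exact neg_mem hx
  | mul x y hx' hy' hx hy =>
    clear hx' hy'
    induction hx using AddSubgroup.closure_induction with
    | mem x hx =>
      induction hy using AddSubgroup.closure_induction with
      | mem y hy =>
        exact (AddSubmonoid.closure_le (S := (AddSubgroup.closure (T.B : Set A)).toAddSubmonoid)).2
          AddSubgroup.subset_closure (T.mul_mem_closure hInt hx hy)
      | zero => rw [mul_zero]; exact zero_mem _
      | add y z _ _ hy hz => rw [mul_add]; exact add_mem hy hz
      | neg y _ hy => rw [mul_neg]; exact neg_mem hy
    | zero => rw [zero_mul]; exact zero_mem _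
    | add x z _ _ hx hz => rw [add_mul]; exact add_mem hx hz
    | neg x _ hx => rw [neg_mul]; exact neg_mem hx

lemma exists_int_ip (T : TAData A) (hInt : T.Integral) {a a' : A}
    (ha : a ∈ T.integralSubring) (ha' : a' ∈ T.integralSubring) : ∃ n : ℤ, T.ip a a' = n := by
  classical
  have h := T.mem_addSubgroup_closure hInt ha
  have h' := T.mem_addSubgroup_closure hInt ha'
  clear ha ha'
  induction h using AddSubgroup.closure_induction with
  | mem x hx =>
    induction h' using AddSubgroup.closure_induction with
    | mem y hy => exact ⟨if x = y then 1 else 0, by rw [T.ip_eq_ite hx hy]; split_ifs <;> simp⟩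
    | zero => exact ⟨0, by simp⟩
    | add y z _ _ hy hz =>
      obtain ⟨m, hm⟩ := hy
      obtain ⟨n, hn⟩ := hz
      exact ⟨m + n, by rw [map_add, hm, hn, Int.cast_add]⟩
    | neg y _ hy =>
      obtain ⟨m, hm⟩ := hy
      exact ⟨-m, by rw [map_neg, hm, Int.cast_neg]⟩
  | zero => exact ⟨0, by simp⟩
  | add x z _ _ hx hz =>
    obtain ⟨m, hm⟩ := hx
    obtain ⟨n, hn⟩ := hz
    exact ⟨m + n, by rw [map_add, LinearMap.add_apply, hm, hn, Int.cast_add]⟩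
  | neg x _ hx =>
    obtain ⟨m, hm⟩ := hx
    exact ⟨-m, by rw [map_neg, LinearMap.neg_apply, hm, Int.cast_neg]⟩

lemma exists_int_deg (T : TAData A) (hInt : T.Integral) {a : A} (ha : a ∈ T.integralSubring) :
    ∃ n : ℤ, T.deg a = n := by
  have h : T.integralSubring ≤ (Int.castRingHom ℂ).range.comap (T.deg : A →+* ℂ) := by
    refine Subring.closure_le.mpr fun b hb => ?_
    obtain ⟨n, -, hn⟩ := hInt.2 b hb
    exact ⟨n, by simp [hn]⟩
  obtain ⟨n, hn⟩ := h ha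
  exact ⟨n, hn.symm⟩

lemma bar_mem_integralSubring (T : TAData A) {a : A} (ha : a ∈ T.integralSubring) :
    T.bar a ∈ T.integralSubring := by
  have h : T.integralSubring ≤ T.integralSubring.comap (T.bar : A →+* A) :=
    Subring.closure_le.mpr fun b hb => T.basis_mem (T.bar_mem b hb)
  exact h ha

/-- The integral combinations of basis elements form an integral table algebra over `ℤ`. -/
lemma exists_intTA (T : TAData A) (hInt : T.Integral) (hSmall : T.NoSmall) :
    ∃ S : IntTA T.integralSubring, (∀ x, x ∈ S.B ↔ (x : A) ∈ T.B) ∧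
      (∀ x, (S.bar x : A) = T.bar x) ∧ (∀ x y, (S.ip x y : ℂ) = T.ip x y) ∧
      ∀ x, (S.deg x : ℂ) = T.deg x := by
  classical
  choose ip hip using fun x y : T.integralSubring => T.exists_int_ip hInt x.2 y.2
  choose deg hdeg using fun x : T.integralSubring => T.exists_int_deg hInt x.2
  have inj := Int.cast_injective (α := ℂ)
  refine ⟨{
    B := T.B.subtype (· ∈ T.integralSubring)
    one_mem := Finset.mem_subtype.mpr T.one_mem
    bar := (T.bar : A →+* A).restrict _ _ fun a ha => T.bar_mem_integralSubring ha
    bar_bar := fun a => Subtype.ext (T.bar_bar a)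
    bar_mem := fun b hb => Finset.mem_subtype.mpr (T.bar_mem b (Finset.mem_subtype.mp hb))
    ip := ip
    ip_add_left := fun a b c => inj (by
      rw [Int.cast_add, ← hip, ← hip, ← hip, Subring.coe_add, map_add, LinearMap.add_apply])
    ip_symm := fun a b => inj (by rw [← hip, ← hip, T.ip_symm])
    ip_self := fun b hb => inj (by
      rw [← hip, T.ip_self b (Finset.mem_subtype.mp hb), Int.cast_one])
    ip_ne := fun b hb c hc h => inj (by
      rw [← hip, T.ip_ne b (Finset.mem_subtype.mp hb) c (Finset.mem_subtype.mp hc)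
        fun h' => h (Subtype.ext h'), Int.cast_zero])
    ip_assoc := fun a b c => inj (by
      rw [← hip, ← hip]
      exact T.ip_assoc a b c)
    deg := {
      toFun := deg
      map_one' := inj (by rw [← hdeg, Subring.coe_one, map_one, Int.cast_one])
      map_mul' := fun a b => inj (by
        rw [Int.cast_mul, ← hdeg, ← hdeg, ← hdeg, Subring.coe_mul, map_mul])
      map_zero' := inj (by rw [← hdeg, Subring.coe_zero, map_zero, Int.cast_zero])
      map_add' := fun a b => inj (by
        rw [Int.cast_add, ← hdeg, ← hdeg, ← hdeg, Subring.coe_add, map_add]) }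
    deg_pos := fun b hb => by
      obtain ⟨n, hn, h⟩ := hInt.2 b (Finset.mem_subtype.mp hb)
      have h' : deg b = n := inj (by rw [← hdeg, h, Int.cast_natCast])
      change 0 < deg b
      omega
    mul_mem := fun b hb c hc => by
      have h := T.mul_mem_closure hInt (Finset.mem_subtype.mp hb) (Finset.mem_subtype.mp hc)
      have hB : (T.B : Set A) = T.integralSubring.subtype.toAddMonoidHom ''
          (T.B.subtype (· ∈ T.integralSubring) : Set T.integralSubring) := by
        ext x
        constructor
        · exact fun hx => ⟨⟨x, T.basis_mem hx⟩, Finset.mem_subtype.mpr hx, rfl⟩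
        · rintro ⟨x, hx, rfl⟩
          exact Finset.mem_subtype.mp hx
      rw [hB, ← AddMonoidHom.map_mclosure] at h
      obtain ⟨x, hx, hx'⟩ := h
      rwa [show b * c = x from Subtype.ext hx'.symm]
    eq_one_or_three_le := fun b hb => by
      obtain ⟨n, hn, h⟩ := hInt.2 b (Finset.mem_subtype.mp hb)
      have h' : deg b = n := inj (by rw [← hdeg, h, Int.cast_natCast])
      change b = 1 ∨ 3 ≤ deg b
      by_cases h1 : n = 1
      · exact Or.inl (Subtype.ext (hSmall.1 b (Finset.mem_subtype.mp hb) (by simp [h, h1])))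
      · have h2 : n ≠ 2 := by
          rintro rfl
          exact hSmall.2 b (Finset.mem_subtype.mp hb) (by simp [h])
        omega }, fun x => Finset.mem_subtype, fun x => rfl, fun x y => (hip x y).symm,
    fun x => (hdeg x).symm⟩

end TAData

/-- Theorem 4.4: there is no NITA generated by a non-real `b₃`
of degree 3 with `b₃b̄₃ = 1 + b₈`, `b₃² = c₃ + b₆` (`c₃ ∉ {b₃, b̄₃}`),
`(b₃b₈, b₃b₈) = 4` and `c₃² = r₄ + s₅`. -/
theorem stmt_13 {A : Type} [CommRing A] [Algebra ℂ A] (T : TAData A)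
    (hInt : T.Integral) (hSmall : T.NoSmall)
    (b3 b8 c3 b6 r4 s5 : A)
    (hb3 : b3 ∈ T.B) (hd3 : T.deg b3 = 3) (hnr : T.bar b3 ≠ b3)
    (hgen : T.GeneratedBy b3)
    (hb8 : b8 ∈ T.B) (hd8 : T.deg b8 = 8)
    (hmul : b3 * T.bar b3 = 1 + b8)
    (hc3 : c3 ∈ T.B) (hdc3 : T.deg c3 = 3) (hc3b3 : c3 ≠ b3) (hc3b3' : c3 ≠ T.bar b3)
    (hb6 : b6 ∈ T.B) (hd6 : T.deg b6 = 6)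
    (hsq : b3 * b3 = c3 + b6)
    (hip : T.ip (b3 * b8) (b3 * b8) = 4)
    (hr4 : r4 ∈ T.B) (hdr4 : T.deg r4 = 4)
    (hs5 : s5 ∈ T.B) (hds5 : T.deg s5 = 5)
    (hcsq : c3 * c3 = r4 + s5) : False := by
  obtain ⟨S, hB, hbar, hipS, hdeg⟩ := T.exists_intTA hInt hSmall
  have lift_deg : ∀ (x : T.integralSubring) (n : ℕ), T.deg x = n → S.deg x = n := by
    intro x n h
    exact_mod_cast (hdeg x).trans h
  let b : T.integralSubring := ⟨b3, T.basis_mem hb3⟩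
  let E : T.integralSubring := ⟨b8, T.basis_mem hb8⟩
  let c : T.integralSubring := ⟨c3, T.basis_mem hc3⟩
  let β : T.integralSubring := ⟨b6, T.basis_mem hb6⟩
  let r : T.integralSubring := ⟨r4, T.basis_mem hr4⟩
  let s : T.integralSubring := ⟨s5, T.basis_mem hs5⟩
  refine IntTA.false_of_csq (T := S) (b := b) (E := E) (c := c) (β := β) (r := r) (s := s)
    ((hB b).mpr hb3) (lift_deg b 3 (by exact_mod_cast hd3)) ((hB E).mpr hb8)
    (lift_deg E 8 (by exact_mod_cast hd8)) (Subtype.ext ?_) ((hB c).mpr hc3)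
    (lift_deg c 3 (by exact_mod_cast hdc3))
    (fun h => hc3b3' ((congrArg Subtype.val h).trans (hbar b))) ((hB β).mpr hb6)
    (lift_deg β 6 (by exact_mod_cast hd6)) (Subtype.ext hsq) ?_ ((hB r).mpr hr4)
    (lift_deg r 4 (by exact_mod_cast hdr4)) ((hB s).mpr hs5)
    (lift_deg s 5 (by exact_mod_cast hds5)) (Subtype.ext hcsq)
  · change b3 * (S.bar b : A) = 1 + b8
    rw [hbar, hmul]
  · exact_mod_cast (hipS (b * E) (b * E)).trans hip
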